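/- arXiv:2508.20192 — 8 statements merged into one kernel-verified Lean document; each statement's English description precedes it below -/
import Mathlib

section
/- Let k be a field with algebraic closure k̄, let n ≥ 2, and let f ∈ k[x₁,…,xₙ] be a (not necessarily homogeneous) polynomial of total degree d ≥ 2 having no factor of degree 1 in k̄[x₁,…,xₙ]. Suppose (v₀,w₀) = (v₁,…,vₙ,w₂,…,wₙ) ∈ k^{2n−1} is such that the univariate polynomial f(X+v₁, w₂X+v₂, …, wₙX+vₙ) ∈ k[X] has degree d and has a simple root α₀ ∈ k̄. Then there exists a nonzero polynomial Ψ ∈ k(α₀)[Z₂,…,Zₙ], depending on v₀ and w₀, of total degree at most 3d−3, such that for every z = (z₂,…,zₙ) ∈ k^{n−1} with Ψ(z₂,…,zₙ) ≠ 0, the polynomial f_{v₀,w₀,z}(X,Y) has no factor of degree 1 in k̄[X,Y] vanishing at the point (α₀,0). -/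
open MvPolynomial

/-- The planar slice polynomial `f_{v,w,z}(X,Y)
  = f(X + v₁, w₂X + z₂Y + v₂, …, wₙX + zₙY + vₙ)`.
Here the variables of `f` are indexed by `Fin (n+1)` (so `f` has `n+1` variables,
corresponding to the paper's `n ≥ 2` variables with our `n ≥ 1`). -/
noncomputable def planarSlice {k : Type*} [CommSemiring k] {n : ℕ}
    (f : MvPolynomial (Fin (n + 1)) k) (v : Fin (n + 1) → k) (w z : Fin n → k) :
    MvPolynomial (Fin 2) k :=
  aeval (Fin.cases (X 0 + C (v 0))
    (fun j => C (w j) * X 0 + C (z j) * X 1 + C (v j.succ)) :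
      Fin (n + 1) → MvPolynomial (Fin 2) k) f

/-- The univariate restriction `f(X + v₁, w₂X + v₂, …, wₙX + vₙ) ∈ k[X]`,
i.e. the planar slice along the line `Y = 0`. -/
noncomputable def lineSlice {k : Type*} [CommSemiring k] {n : ℕ}
    (f : MvPolynomial (Fin (n + 1)) k) (v : Fin (n + 1) → k) (w : Fin n → k) :
    Polynomial k :=
  aeval (Fin.cases (Polynomial.X + Polynomial.C (v 0))
    (fun j => Polynomial.C (w j) * Polynomial.X + Polynomial.C (v j.succ)) :
      Fin (n + 1) → Polynomial k) f

/-- The chain rule for a univariate polynomial curve substituted in a multivariate polynomial. -/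
theorem derivative_aeval_eq_sum {k A σ : Type*} [CommRing k] [CommRing A] [Algebra k A] [Fintype σ]
    (q : σ → Polynomial A) (f : MvPolynomial σ k) :
    Polynomial.derivative (aeval q f) =
      ∑ i, aeval q (pderiv i f) * Polynomial.derivative (q i) := by
  classical
  induction f using MvPolynomial.induction_on with
  | C a =>
    simp [IsScalarTower.algebraMap_apply k A (Polynomial A)]
  | add p q hp hq => simp [hp, hq, add_mul, Finset.sum_add_distrib]
  | mul_X p i hp =>
    have hX : ∑ j, aeval q p * aeval q (pderiv j (X i : MvPolynomial σ k)) *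
        Polynomial.derivative (q j) = aeval q p * Polynomial.derivative (q i) := by
      rw [Finset.sum_eq_single i]
      · rw [pderiv_X_self, map_one, mul_one]
      · intro j _ hj
        rw [pderiv_X_of_ne hj.symm, map_zero, mul_zero, zero_mul]
      · simp
    rw [map_mul, aeval_X, Polynomial.derivative_mul, hp, ← hX, Finset.sum_mul,
      ← Finset.sum_add_distrib]
    refine Finset.sum_congr rfl fun j _ => ?_
    rw [Derivation.leibniz, map_add, smul_eq_mul, smul_eq_mul, map_mul, map_mul, aeval_X]
    ring

theorem aeval_line_eval_zero {k F σ : Type*} [CommRing k] [CommRing F] [Algebra k F]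
    (P u : σ → F) (f : MvPolynomial σ k) :
    (aeval (fun i => Polynomial.C (P i) + Polynomial.C (u i) * Polynomial.X) f).eval 0 =
      aeval P f := by
  have := comp_aeval_apply (fun i => Polynomial.C (P i) + Polynomial.C (u i) * Polynomial.X)
    ((Polynomial.aeval (0 : F)).restrictScalars k) f
  simpa [Polynomial.aeval_def, Polynomial.eval₂_eq_eval_map] using this

theorem derivative_aeval_line_eval_zero {k F σ : Type*} [CommRing k] [CommRing F] [Algebra k F]
    [Fintype σ] (P u : σ → F) (f : MvPolynomial σ k) :
    (Polynomial.derivative (aeval (fun i => Polynomial.C (P i) + Polynomial.C (u i) * Polynomial.X)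
      f)).eval 0 = ∑ i, aeval P (pderiv i f) * u i := by
  simp [derivative_aeval_eq_sum, Polynomial.eval_finsetSum, aeval_line_eval_zero]

/-- If the variables are replaced by polynomials in `T` whose coefficients have total degree at
most one, then the coefficients of the result have total degree at most that of `f`. -/
theorem totalDegree_coeff_aeval_le {k K σ τ : Type*} [CommRing k] [CommRing K] [Algebra k K]
    (q : σ → Polynomial (MvPolynomial τ K)) (hq : ∀ j i, ((q j).coeff i).totalDegree ≤ 1)
    (f : MvPolynomial σ k) (i : ℕ) : ((aeval q f).coeff i).totalDegree ≤ f.totalDegree := by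
  have hmul {a b : ℕ} {p r : Polynomial (MvPolynomial τ K)}
      (hp : ∀ i, (p.coeff i).totalDegree ≤ a) (hr : ∀ i, (r.coeff i).totalDegree ≤ b) (i : ℕ) :
      ((p * r).coeff i).totalDegree ≤ a + b := by
    rw [Polynomial.coeff_mul]
    exact totalDegree_finsetSum_le fun x _ =>
      (totalDegree_mul _ _).trans (add_le_add (hp _) (hr _))
  have hpow (j : σ) (m : ℕ) : ∀ i, ((q j ^ m).coeff i).totalDegree ≤ m := by
    induction m with
    | zero =>
      intro i
      rw [pow_zero, Polynomial.coeff_one]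
      split_ifs <;> simp
    | succ m ih =>
      rw [pow_succ]
      exact hmul ih (hq j)
  have hprod (s : Finset σ) (m : σ → ℕ) :
      ∀ i, ((∏ j ∈ s, q j ^ m j).coeff i).totalDegree ≤ ∑ j ∈ s, m j := by
    classical
    induction s using Finset.induction_on with
    | empty =>
      intro i
      rw [Finset.prod_empty, Polynomial.coeff_one]
      split_ifs <;> simp
    | insert a s ha ih =>
      rw [Finset.prod_insert ha, Finset.sum_insert ha]
      exact hmul (hpow a _) ih
  rw [aeval_def, eval₂_eq, Polynomial.finsetSum_coeff]
  refine totalDegree_finsetSum_le fun m hm => ?_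
  rw [← Algebra.smul_def, Polynomial.coeff_smul, ← algebraMap_smul (A := K)]
  exact (totalDegree_smul_le _ _).trans ((hprod _ _ _).trans (le_totalDegree hm))

/-- A polynomial vanishes modulo `L` as soon as it vanishes at a point congruent to the generic
point modulo `L`. -/
theorem dvd_of_aeval_eq_zero {σ F : Type*} [CommRing F] (L : MvPolynomial σ F)
    (x : σ → MvPolynomial σ F) (hx : ∀ i, L ∣ X i - x i) (f : MvPolynomial σ F)
    (hf : aeval x f = 0) : L ∣ f := by
  rw [← Ideal.mem_span_singleton, ← Ideal.Quotient.eq_zero_iff_mem]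
  have h := comp_aeval_apply x (Ideal.Quotient.mkₐ F (Ideal.span {L})) f
  have hX := comp_aeval_apply X (Ideal.Quotient.mkₐ F (Ideal.span {L})) f
  have hxX : (fun i => Ideal.Quotient.mkₐ F (Ideal.span {L}) (x i)) =
      fun i => Ideal.Quotient.mkₐ F (Ideal.span {L}) (X i) := by
    ext i
    refine (Ideal.Quotient.eq.mpr ?_).symm
    exact Ideal.mem_span_singleton.mpr (hx i)
  rw [hf, map_zero, hxX, ← hX, aeval_X_left_apply] at h
  exact h.symm

theorem Polynomial.eq_zero_of_natDegree_le_one {F : Type*} [CommRing F] {p : Polynomial F}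
    (hp : p.natDegree ≤ 1) {t : F} (h0 : p.eval t = 0) (h1 : p.derivative.eval t = 0) :
    p = 0 := by
  obtain ⟨a, b, rfl⟩ := Polynomial.exists_eq_X_add_C_of_natDegree_le_one hp
  have ha : a = 0 := by simpa using h1
  subst ha
  simpa using h0

/-- The point with parameter `α` on the line along which `lineSlice` restricts. -/
def linePoint {k K : Type*} [CommRing k] [CommRing K] [Algebra k K] {n : ℕ}
    (v : Fin (n + 1) → k) (w : Fin n → k) (α : K) : Fin (n + 1) → K :=
  Fin.cases (α + algebraMap k K (v 0))
    (fun j => algebraMap k K (w j) * α + algebraMap k K (v j.succ))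

/-- The direction `c • (1, w) + (0, z)`. -/
def sliceDirection {k K : Type*} [CommRing k] [CommRing K] [Algebra k K] {n : ℕ}
    (w : Fin n → k) (c : K) (z : Fin n → K) : Fin (n + 1) → K :=
  Fin.cases c (fun j => algebraMap k K (w j) * c + z j)

theorem aeval_derivative_lineSlice {k K : Type*} [CommRing k] [CommRing K] [Algebra k K] {n : ℕ}
    (f : MvPolynomial (Fin (n + 1)) k) (v : Fin (n + 1) → k) (w : Fin n → k) (α : K) :
    Polynomial.aeval α (Polynomial.derivative (lineSlice f v w)) =
      ∑ i, aeval (linePoint v w α) (pderiv i f) * sliceDirection w 1 0 i := by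
  rw [lineSlice, derivative_aeval_eq_sum, map_sum]
  refine Finset.sum_congr rfl fun i _ => ?_
  rw [map_mul, comp_aeval_apply]
  congr 1
  · congr 2
    ext i
    cases i using Fin.cases <;> simp [linePoint]
  · cases i using Fin.cases <;> simp [sliceDirection]

theorem aeval_planarSlice {k K : Type*} [CommRing k] [CommRing K] [Algebra k K] {n : ℕ}
    (f : MvPolynomial (Fin (n + 1)) k) (v : Fin (n + 1) → k) (w z : Fin n → k) (α c b : K) :
    aeval (fun i => Polynomial.C (![α, 0] i) + Polynomial.C (![c, b] i) * Polynomial.X)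
        (planarSlice f v w z) =
      aeval (fun i => Polynomial.C (linePoint v w α i) +
        Polynomial.C (sliceDirection w c (fun j => algebraMap k K (z j) * b) i) *
          Polynomial.X) f := by
  rw [planarSlice, comp_aeval_apply]
  congr 2
  ext1 i
  cases i using Fin.cases with
  | zero =>
    simp [linePoint, sliceDirection, IsScalarTower.algebraMap_apply k K (Polynomial K)]
    ring
  | succ j =>
    simp [linePoint, sliceDirection, IsScalarTower.algebraMap_apply k K (Polynomial K)]
    ring

/-- If the planar slice has a linear factor through `(α, 0)`, then `f` vanishes identically along
a line through `linePoint v w α`. -/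
theorem exists_aeval_line_eq_zero {k F : Type*} [Field k] [Field F] [Algebra k F] {n : ℕ}
    (f : MvPolynomial (Fin (n + 1)) k) (v : Fin (n + 1) → k) (w z : Fin n → k) (α : F)
    (hsimple : Polynomial.aeval α (Polynomial.derivative (lineSlice f v w)) ≠ 0)
    (g : MvPolynomial (Fin 2) F) (hg : g.totalDegree ≤ 1)
    (hdvd : g ∣ MvPolynomial.map (algebraMap k F) (planarSlice f v w z))
    (h0 : eval ![α, 0] g = 0) :
    ∃ c : F, aeval (fun i => Polynomial.C (linePoint v w α i) +
      Polynomial.C (sliceDirection w c (fun j => algebraMap k F (z j)) i) * Polynomial.X) f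
        = 0 := by
  have key (c b : F) (hcb : aeval ![α, 0] (pderiv 0 g) * c + aeval ![α, 0] (pderiv 1 g) * b = 0) :
      aeval (fun i => Polynomial.C (linePoint v w α i) +
        Polynomial.C (sliceDirection w c (fun j => algebraMap k F (z j) * b) i) *
          Polynomial.X) f = 0 := by
    have hgz : aeval (fun i => Polynomial.C (![α, 0] i) +
        Polynomial.C (![c, b] i) * Polynomial.X) g = 0 := by
      refine Polynomial.eq_zero_of_natDegree_le_one (t := 0) ?_ ?_ ?_
      · refine aeval_natDegree_le (m := 1) (n := 1) g hg _ fun i => ?_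
        compute_degree
      · rw [aeval_line_eval_zero, aeval_eq_eval, h0]
      · rw [derivative_aeval_line_eval_zero, Fin.sum_univ_two]
        simpa using hcb
    rw [← aeval_planarSlice, ← aeval_map_algebraMap F]
    obtain ⟨r, hr⟩ := hdvd
    rw [hr, map_mul, hgz, zero_mul]
  by_cases ha : aeval ![α, 0] (pderiv 0 g) = 0
  · have h := congrArg (fun p => (Polynomial.derivative p).eval 0) (key 1 0 (by simp [ha]))
    simp only [mul_zero, derivative_aeval_line_eval_zero] at h
    rw [aeval_derivative_lineSlice] at hsimple
    exact absurd (by simpa using! h) hsimple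
  · refine ⟨-aeval ![α, 0] (pderiv 1 g) / aeval ![α, 0] (pderiv 0 g), ?_⟩
    simpa using key (-aeval ![α, 0] (pderiv 1 g) / aeval ![α, 0] (pderiv 0 g)) 1
      (by field_simp; ring)

/-- If `f` vanishes along the generic line in a hyperplane through `linePoint v w α` that is
transverse to `(1, w)`, then `f` has a linear factor. -/
theorem exists_linear_factor {k K : Type*} [Field k] [Field K] [Algebra k K] {n : ℕ}
    (f : MvPolynomial (Fin (n + 1)) k) (v : Fin (n + 1) → k) (w : Fin n → k) (α : K)
    (s : Fin n → K)
    (h : aeval (fun i => Polynomial.C (C (linePoint v w α i)) +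
      Polynomial.C (sliceDirection w (∑ j, C (s j) * X j) X i : MvPolynomial (Fin n) K) *
        Polynomial.X) f = 0) :
    ∃ L : MvPolynomial (Fin (n + 1)) K, L.totalDegree = 1 ∧
      L ∣ MvPolynomial.map (algebraMap k K) f := by
  set P := linePoint v w α
  let y : Fin n → MvPolynomial (Fin (n + 1)) K := fun j =>
    X j.succ - C (P j.succ) - C (algebraMap k K (w j)) * (X 0 - C (P 0))
  let S := ∑ j, C (s j) * y j
  let x : Fin (n + 1) → MvPolynomial (Fin (n + 1)) K := fun i => C (P i) + sliceDirection w S y i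
  have hx : aeval x f = 0 := by
    have := congrArg (((aeval y).restrictScalars k).comp
      ((Polynomial.aeval (1 : MvPolynomial (Fin n) K)).restrictScalars k)) h
    rw [map_zero, comp_aeval_apply] at this
    rw [← this]
    congr 2
    ext1 i
    cases i using Fin.cases <;>
      simp [x, sliceDirection, S, MvPolynomial.algebraMap_apply, Polynomial.eval_finsetSum]
  have hyd (j : Fin n) : (y j).totalDegree ≤ 1 := by
    have hX (i : Fin (n + 1)) : (X i - C (P i) : MvPolynomial (Fin (n + 1)) K).totalDegree ≤ 1 :=
      (totalDegree_sub_C_le _ _).trans (totalDegree_X _).le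
    refine (totalDegree_sub _ _).trans (max_le (hX _) ?_)
    exact (totalDegree_mul _ _).trans (by simpa using hX 0)
  have hLd : (X 0 - x 0).totalDegree ≤ 1 := by
    refine (totalDegree_sub _ _).trans (max_le (totalDegree_X _).le ?_)
    refine (totalDegree_add _ _).trans (max_le (by simp) ?_)
    change (∑ j, C (s j) * y j).totalDegree ≤ 1
    exact totalDegree_finsetSum_le fun j _ => (totalDegree_mul _ _).trans (by simpa using hyd j)
  have heval (t : K) : eval (fun i => P i + sliceDirection w t 0 i) (X 0 - x 0) = t := by
    simp [x, sliceDirection, S, y]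
  refine ⟨X 0 - x 0, le_antisymm hLd (Nat.one_le_iff_ne_zero.mpr fun h0 => ?_), ?_⟩
  · rw [totalDegree_eq_zero_iff_eq_C] at h0
    have h1 := heval 1
    have h2 := heval 0
    rw [h0, eval_C] at h1 h2
    exact one_ne_zero (h1.symm.trans h2)
  · refine dvd_of_aeval_eq_zero _ x (fun i => ?_) _ (by rw [aeval_map_algebraMap, hx])
    cases i using Fin.cases with
    | zero => rfl
    | succ j =>
      refine ⟨C (algebraMap k K (w j)), ?_⟩
      simp only [x, sliceDirection, Fin.cases_succ, Fin.cases_zero, y,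
        MvPolynomial.algebraMap_apply]
      ring

/-- If `f` has no linear factor over `F`, then the planar slices through a line with a simple point
`α` have no linear factor through `(α, 0)`, outside a hypersurface of degree at most that of `f`. -/
theorem exists_polynomial_no_linear_factor {k K F : Type*} [Field k] [Field K] [Field F]
    [Algebra k K] [Algebra K F] [Algebra k F] [IsScalarTower k K F] {n : ℕ}
    (f : MvPolynomial (Fin (n + 1)) k)
    (hnolin : ¬ ∃ g : MvPolynomial (Fin (n + 1)) F,
      g.totalDegree = 1 ∧ g ∣ MvPolynomial.map (algebraMap k F) f)
    (v : Fin (n + 1) → k) (w : Fin n → k) (α : K)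
    (hsimple : Polynomial.aeval α (Polynomial.derivative (lineSlice f v w)) ≠ 0) :
    ∃ Ψ : MvPolynomial (Fin n) K, Ψ ≠ 0 ∧ Ψ.totalDegree ≤ f.totalDegree ∧
      ∀ z : Fin n → k, eval (fun j => algebraMap k K (z j)) Ψ ≠ 0 →
        ¬ ∃ g : MvPolynomial (Fin 2) F, g.totalDegree ≤ 1 ∧
          g ∣ MvPolynomial.map (algebraMap k F) (planarSlice f v w z) ∧
          eval ![algebraMap K F α, 0] g = 0 := by
  have hinj := (algebraMap K F).injective
  set a := Polynomial.aeval α (Polynomial.derivative (lineSlice f v w)) with ha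
  set P := linePoint v w α
  let s : Fin n → K := fun j => -aeval P (pderiv j.succ f) / a
  set φ : Polynomial (MvPolynomial (Fin n) K) := aeval (fun i => Polynomial.C (C (P i)) +
      Polynomial.C (sliceDirection w (∑ j, C (s j) * X j) X i) * Polynomial.X) f with hφ
  have hφ0 : φ ≠ 0 := by
    intro h
    obtain ⟨L, hL, hdvd⟩ := exists_linear_factor f v w α s h
    refine hnolin ⟨MvPolynomial.map (algebraMap K F) L, ?_, ?_⟩
    · rw [totalDegree, support_map_of_injective _ hinj, ← totalDegree, hL]
    · have := map_dvd (MvPolynomial.map (σ := Fin (n + 1)) (algebraMap K F)) hdvd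
      rwa [map_map, ← IsScalarTower.algebraMap_eq] at this
  obtain ⟨i, hi⟩ : ∃ i, φ.coeff i ≠ 0 := by
    by_contra! h
    exact hφ0 (Polynomial.ext h)
  refine ⟨φ.coeff i, hi, totalDegree_coeff_aeval_le _ (fun j m => ?_) f i, ?_⟩
  · have hS : (∑ j, C (s j) * X j : MvPolynomial (Fin n) K).totalDegree ≤ 1 :=
      totalDegree_finsetSum_le fun j _ => (totalDegree_mul _ _).trans (by simp)
    have hdir : (sliceDirection w (∑ j, C (s j) * X j) X j :
        MvPolynomial (Fin n) K).totalDegree ≤ 1 := by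
      cases j using Fin.cases with
      | zero => exact hS
      | succ j =>
        refine (totalDegree_add _ _).trans (max_le ((totalDegree_mul _ _).trans ?_) (by simp))
        simpa [MvPolynomial.algebraMap_apply] using hS
    rw [Polynomial.coeff_add, Polynomial.coeff_C, Polynomial.coeff_C_mul, Polynomial.coeff_X]
    refine (totalDegree_add _ _).trans (max_le ?_ ?_)
    · split_ifs <;> simp
    · split_ifs <;> simp [hdir]
  · rintro z hz ⟨g, hg, hdvd, h0⟩
    have hsF : Polynomial.aeval (algebraMap K F α) (Polynomial.derivative (lineSlice f v w)) =
        algebraMap K F a := Polynomial.aeval_algebraMap_apply _ _ _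
    obtain ⟨c, hc⟩ := exists_aeval_line_eq_zero f v w z (algebraMap K F α)
      (by rw [hsF]; exact (map_ne_zero _).mpr hsimple) g hg hdvd h0
    have hP : linePoint v w (algebraMap K F α) = algebraMap K F ∘ P := by
      ext i
      cases i using Fin.cases <;> simp [P, linePoint, ← IsScalarTower.algebraMap_apply]
    have hcs : c = ∑ j, algebraMap K F (s j) * algebraMap k F (z j) := by
      have hd := congrArg (fun p => (Polynomial.derivative p).eval 0) hc
      have haF := congrArg (algebraMap K F) (aeval_derivative_lineSlice f v w α)
      rw [← ha] at haF
      simp only [derivative_aeval_line_eval_zero, Polynomial.derivative_zero,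
        Polynomial.eval_zero, hP, MvPolynomial.aeval_algebraMap_apply, Fin.sum_univ_succ, sliceDirection,
        Fin.cases_zero, Fin.cases_succ, mul_add, Finset.sum_add_distrib] at hd
      simp only [Fin.sum_univ_succ, sliceDirection, Fin.cases_zero, Fin.cases_succ, map_add,
        map_sum, map_mul, mul_one, Pi.zero_apply, add_zero,
        ← IsScalarTower.algebraMap_apply] at haF
      have haF0 : algebraMap K F a ≠ 0 := (map_ne_zero _).mpr hsimple
      refine mul_left_cancel₀ haF0 ?_
      have hr : algebraMap K F a * ∑ j, algebraMap K F (s j) * algebraMap k F (z j) =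
          -∑ j, algebraMap K F (aeval P (pderiv (Fin.succ j) f)) * algebraMap k F (z j) := by
        rw [Finset.mul_sum, ← Finset.sum_neg_distrib]
        refine Finset.sum_congr rfl fun j _ => ?_
        simp only [s, map_div₀, map_neg]
        field_simp
      rw [hr, haF, add_mul, Finset.sum_mul, eq_neg_iff_add_eq_zero, ← hd, add_assoc]
      simp only [mul_assoc, P]
    let ψ : MvPolynomial (Fin n) K →ₐ[k] F :=
      (aeval (fun j => algebraMap k F (z j))).restrictScalars k
    have hψ : Polynomial.mapAlgHom ψ φ = 0 := by
      rw [hφ, comp_aeval_apply, ← hc, hP]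
      congr 2
      ext1 i
      cases i using Fin.cases <;>
        simp [sliceDirection, ψ, hcs, Polynomial.map_sum, ← IsScalarTower.algebraMap_apply]
    have hcoeff := congrArg (fun p => Polynomial.coeff p i) hψ
    refine hz (hinj ?_)
    rw [map_zero, ← aeval_eq_eval, ← MvPolynomial.aeval_algebraMap_apply]
    simpa [ψ, Function.comp_def, ← IsScalarTower.algebraMap_apply] using hcoeff

/-- **Theorem B / Theorem 2.4 (effective Bertini, modified).**
Suppose `f` has total degree `d ≥ 2`, no degree-one factor over the algebraic closure,
and for some `(v₀, w₀)` the univariate polynomial `f(X+v₁, w₂X+v₂, …, wₙX+vₙ)` has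
degree `d` and a simple root `α₀` in the algebraic closure. Then there is a nonzero
polynomial `Ψ` over `k(α₀)` in the variables `Z₂, …, Zₙ` of total degree at most
`3d - 3` such that whenever `Ψ(z) ≠ 0` for `z ∈ k^{n-1}`, the planar slice
`f_{v₀,w₀,z}` has no degree-one factor over the algebraic closure vanishing
at `(α₀, 0)`. -/
theorem stmt3 (k : Type*) [Field k] (n d : ℕ) (hn : 1 ≤ n) (hd : 2 ≤ d)
    (f : MvPolynomial (Fin (n + 1)) k)
    (hdeg : f.totalDegree = d)
    (hnolin : ¬ ∃ g : MvPolynomial (Fin (n + 1)) (AlgebraicClosure k),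
      g.totalDegree = 1 ∧ g ∣ MvPolynomial.map (algebraMap k (AlgebraicClosure k)) f)
    (v : Fin (n + 1) → k) (w : Fin n → k)
    (hunideg : (lineSlice f v w).natDegree = d)
    (α₀ : AlgebraicClosure k)
    (hroot : Polynomial.aeval α₀ (lineSlice f v w) = 0)
    (hsimple : Polynomial.aeval α₀ (Polynomial.derivative (lineSlice f v w)) ≠ 0) :
    ∃ Ψ : MvPolynomial (Fin n) (IntermediateField.adjoin k {α₀}),
      Ψ ≠ 0 ∧ Ψ.totalDegree ≤ 3 * d - 3 ∧
      ∀ z : Fin n → k,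
        MvPolynomial.eval
            (fun j => algebraMap k (IntermediateField.adjoin k {α₀}) (z j)) Ψ ≠ 0 →
        ¬ ∃ g : MvPolynomial (Fin 2) (AlgebraicClosure k),
            g.totalDegree = 1 ∧
            g ∣ MvPolynomial.map (algebraMap k (AlgebraicClosure k))
                (planarSlice f v w z) ∧
            MvPolynomial.eval ![α₀, 0] g = 0 := by
  have hα : algebraMap _ (AlgebraicClosure k) (IntermediateField.AdjoinSimple.gen k α₀) = α₀ :=
    IntermediateField.AdjoinSimple.algebraMap_gen k α₀
  obtain ⟨Ψ, hΨ, hΨd, h⟩ := exists_polynomial_no_linear_factor f hnolin v w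
    (IntermediateField.AdjoinSimple.gen k α₀) (fun h0 => hsimple (by
      rw [← hα, Polynomial.aeval_algebraMap_apply, h0, map_zero]))
  refine ⟨Ψ, hΨ, by omega, fun z hz => ?_⟩
  rintro ⟨g, hg, hdvd, hg0⟩
  exact h z hz ⟨g, hg.le, hdvd, by rwa [hα]⟩
end

section
/- Let k be a field, d ≥ 1 an integer, and let f ∈ k[X,Y] have total degree at most d with the coefficient of X^d in f nonzero. Let a, b ∈ k and let α ∈ k[Y] be a polynomial such that f(α(Y),Y) ≡ 0 (mod Y^{d+1}) and α(Y) + aY + b ≡ 0 (mod Y^{d+1}) in k[Y]. Then the linear polynomial X + aY + b divides f in k[X,Y]. -/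
open MvPolynomial

/-- Evaluations of a multivariate polynomial at points congruent modulo `c` are congruent
modulo `c`. -/
theorem MvPolynomial.dvd_aeval_sub_aeval {σ R S : Type*} [CommRing R] [CommRing S] [Algebra R S]
    {c : S} {g h : σ → S} (hgh : ∀ i, c ∣ g i - h i) (f : MvPolynomial σ R) :
    c ∣ aeval g f - aeval h f := by
  induction f using MvPolynomial.induction_on with
  | C r => simp
  | add p q hp hq =>
    rw [map_add, map_add, add_sub_add_comm]
    exact dvd_add hp hq
  | mul_X p i hp =>
    rw [map_mul, map_mul, aeval_X, aeval_X]
    exact dvd_mul_sub_mul hp (hgh i)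

/-- **Key divisibility step in Proposition 2.1.**
Let `f ∈ k[X,Y]` have total degree at most `d` with nonzero coefficient of `X^d`.
If `α ∈ k[Y]` satisfies `f(α(Y), Y) ≡ 0 (mod Y^{d+1})` and
`α(Y) + aY + b ≡ 0 (mod Y^{d+1})`, then `X + aY + b` divides `f` in `k[X,Y]`.
Here the variable `X 0` plays the role of `X` and `X 1` the role of `Y`. -/
theorem stmt5 (k : Type*) [Field k] (d : ℕ) (hd : 1 ≤ d)
    (f : MvPolynomial (Fin 2) k) (hdeg : f.totalDegree ≤ d)
    (hlead : MvPolynomial.coeff (Finsupp.single 0 d) f ≠ 0)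
    (a b : k) (α : Polynomial k)
    (h1 : (Polynomial.X : Polynomial k) ^ (d + 1) ∣
      MvPolynomial.aeval ![α, Polynomial.X] f)
    (h2 : (Polynomial.X : Polynomial k) ^ (d + 1) ∣
      (α + Polynomial.C a * Polynomial.X + Polynomial.C b)) :
    (X 0 + C a * X 1 + C b : MvPolynomial (Fin 2) k) ∣ f := by
  set L : Polynomial k := -(Polynomial.C a * Polynomial.X + Polynomial.C b) with hL
  have hg_dvd : (Polynomial.X : Polynomial k) ^ (d + 1) ∣ aeval ![L, Polynomial.X] f := by
    refine (dvd_iff_dvd_of_dvd_sub (dvd_aeval_sub_aeval (fun i => ?_) f)).1 h1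
    fin_cases i
    · simpa [hL, add_assoc, -neg_add_rev] using h2
    · simp
  have hg_deg : (aeval ![L, Polynomial.X] f).natDegree ≤ d := by
    have h := MvPolynomial.aeval_natDegree_le f hdeg ![L, Polynomial.X] (n := 1) (fun i => by
      fin_cases i
      · exact (Polynomial.natDegree_neg _).trans_le Polynomial.natDegree_linear_le
      · simp)
    simpa using h
  have hg : aeval ![L, Polynomial.X] f = 0 := by
    by_contra hne
    have h := Polynomial.natDegree_le_of_dvd hg_dvd hne
    rw [Polynomial.natDegree_X_pow] at h
    omega
  have hcomp : aeval ![-(C a * X 1 + C b), X 1] f = (0 : MvPolynomial (Fin 2) k) := by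
    have h := congrArg (Polynomial.aeval (X 1 : MvPolynomial (Fin 2) k)) hg
    rw [map_zero, comp_aeval_apply] at h
    rw [← h]
    congr 2
    ext1 i
    fin_cases i <;> simp [hL, algebraMap_eq]
  have h := dvd_aeval_sub_aeval (c := (X 0 + C a * X 1 + C b : MvPolynomial (Fin 2) k))
    (g := X) (h := ![-(C a * X 1 + C b), X 1]) (fun i => by fin_cases i <;> simp [add_assoc, -neg_add_rev]) f
  rwa [hcomp, sub_zero, aeval_X_left_apply] at h
end

section
/- Let k be a perfect field with algebraic closure k̄, and let f ∈ k[X,Y] be a polynomial of total degree d such that f(X,0) ∈ k[X] has degree d and has a simple root α₀ ∈ k̄ (that is, (X−α₀) divides f(X,0) in k̄[X] but (X−α₀)² does not). Suppose f = g·h in k̄[X,Y] with g of total degree 1 and g(α₀,0) = 0. Then there is a nonzero scalar c ∈ k̄ such that c·g has all coefficients in k(α₀), the subfield of k̄ generated over k by α₀. -/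
open MvPolynomial

/-- A bivariate polynomial of total degree at most one is an affine form. -/
lemma MvPolynomial.exists_eq_affine_of_totalDegree_le_one {R : Type*} [CommRing R]
    (g : MvPolynomial (Fin 2) R) (hg : g.totalDegree ≤ 1) :
    ∃ a b c : R, g = C a * X 0 + C b * X 1 + C c := by
  refine ⟨coeff (Finsupp.single 0 1) g, coeff (Finsupp.single 1 1) g, coeff 0 g, ?_⟩
  ext m
  have hm : m = Finsupp.single 0 (m 0) + Finsupp.single 1 (m 1) := by
    ext i; fin_cases i <;> simp
  generalize m 0 = p at hm
  generalize m 1 = q at hm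
  subst hm
  by_cases hpq : 1 < p + q
  · rw [coeff_eq_zero_of_totalDegree_lt]
    · simp only [coeff_add, coeff_C_mul, coeff_X, coeff_C, Finsupp.ext_iff, Fin.forall_fin_two]
      simp
      split_ifs <;> first | omega | simp
    · refine lt_of_le_of_lt hg ?_
      change 1 < Finsupp.degree _
      simpa using hpq
  · have hcases : (p = 0 ∧ q = 0) ∨ (p = 1 ∧ q = 0) ∨ (p = 0 ∧ q = 1) := by omega
    rcases hcases with ⟨rfl, rfl⟩ | ⟨rfl, rfl⟩ | ⟨rfl, rfl⟩ <;>
      simp [coeff_X, coeff_C, Finsupp.ext_iff, Fin.forall_fin_two]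

/-- Restricting a bivariate polynomial to the line `Y = 0` commutes with extending scalars. -/
lemma MvPolynomial.map_aeval_X_zero {R S : Type*} [CommRing R] [CommRing S] (φ : R →+* S)
    (f : MvPolynomial (Fin 2) R) :
    (aeval ![Polynomial.X, 0] f : Polynomial R).map φ =
      aeval ![Polynomial.X, 0] (MvPolynomial.map φ f) := by
  induction f using MvPolynomial.induction_on with
  | C a => simp
  | add p q hp hq => simp [hp, hq]
  | mul_X p i hp => fin_cases i <;> simp [hp]

/-- Restricting to `Y = 0` and then evaluating at `x` is evaluating at `(x, 0)`. -/
lemma MvPolynomial.eval_aeval_X_zero {R : Type*} [CommRing R] (x : R)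
    (f : MvPolynomial (Fin 2) R) :
    (aeval ![Polynomial.X, 0] f : Polynomial R).eval x = eval ![x, 0] f := by
  induction f using MvPolynomial.induction_on with
  | C a => simp
  | add p q hp hq => simp [hp, hq]
  | mul_X p i hp => fin_cases i <;> simp [hp]

/-- If two lines through `(α, 0)` with different slopes both divide `F`, then `F(X, 0)` has a
multiple root at `α`. -/
lemma MvPolynomial.sq_dvd_aeval_X_zero_of_affine_factors {L : Type*} [Field L]
    {F h h' : MvPolynomial (Fin 2) L} {α a a' b b' : L} (hab : a * b' ≠ a' * b)
    (ha : a ≠ 0)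
    (hF : F = (C a * X 0 + C b * X 1 + C (-(a * α))) * h)
    (hF' : F = (C a' * X 0 + C b' * X 1 + C (-(a' * α))) * h') :
    (Polynomial.X - Polynomial.C α) ^ 2 ∣ (aeval ![Polynomial.X, 0] F : Polynomial L) := by
  let ψ : MvPolynomial (Fin 2) L →ₐ[L] Polynomial L :=
    aeval ![Polynomial.C α - Polynomial.C (b / a) * Polynomial.X, Polynomial.X]
  have hline : ψ F = 0 := by
    have hC : Polynomial.C a * Polynomial.C (b / a) = Polynomial.C b := by
      rw [← Polynomial.C_mul, mul_div_cancel₀ _ ha]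
    have : ψ (C a * X 0 + C b * X 1 + C (-(a * α))) = 0 := by
      simp [ψ]
      linear_combination (-Polynomial.X) * hC
    rw [hF, map_mul, this, zero_mul]
  have hψh' : ψ h' = 0 := by
    have hlin : ψ (C a' * X 0 + C b' * X 1 + C (-(a' * α))) =
        Polynomial.C (b' - a' * (b / a)) * Polynomial.X := by
      simp [ψ]
      ring
    rw [hF', map_mul, hlin] at hline
    refine (mul_eq_zero.mp hline).resolve_left
      (mul_ne_zero (Polynomial.C_ne_zero.mpr fun h0 => hab ?_) Polynomial.X_ne_zero)
    field_simp at h0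
    linear_combination h0
  have hh' : eval ![α, 0] h' = 0 := by
    have hcomp : ∀ p : MvPolynomial (Fin 2) L, (ψ p).eval 0 = eval ![α, 0] p := by
      intro p
      induction p using MvPolynomial.induction_on with
      | C a => simp [ψ]
      | add p q hp hq => simp [hp, hq]
      | mul_X p i hp => rw [map_mul, Polynomial.eval_mul, hp]; fin_cases i <;> simp [ψ]
    rw [← hcomp, hψh', Polynomial.eval_zero]
  rw [← eval_aeval_X_zero, ← Polynomial.IsRoot.def, ← Polynomial.dvd_iff_isRoot] at hh'
  rw [hF', map_mul, pow_two]
  refine mul_dvd_mul ⟨Polynomial.C a', ?_⟩ hh'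
  simp
  ring

/-- A line through `(α, 0)` that divides a polynomial `f` over `k`, where `α` is a simple root of
`f(X, 0)`, is defined over `k(α)`. -/
lemma MvPolynomial.exists_mul_coeff_mem_adjoin_of_simple_root {k L : Type*} [Field k] [Field L]
    [Algebra k L] [IsGalois k L] {f : MvPolynomial (Fin 2) k} {α₀ : L}
    (hsimple : ¬ (Polynomial.X - Polynomial.C α₀) ^ 2 ∣
      (aeval ![Polynomial.X, 0] f : Polynomial k).map (algebraMap k L))
    {g h : MvPolynomial (Fin 2) L} (hfactor : MvPolynomial.map (algebraMap k L) f = g * h)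
    (hg1 : g.totalDegree ≤ 1) (hgv : eval ![α₀, 0] g = 0) :
    ∃ c : L, c ≠ 0 ∧ ∀ m : Fin 2 →₀ ℕ, c * coeff m g ∈ IntermediateField.adjoin k {α₀} := by
  rw [map_aeval_X_zero] at hsimple
  obtain ⟨a, b, c, rfl⟩ := exists_eq_affine_of_totalDegree_le_one g hg1
  obtain rfl : c = -(a * α₀) := by
    simp at hgv
    linear_combination hgv
  have ha : a ≠ 0 := by
    rintro rfl
    exact hsimple (by rw [hfactor]; simp)
  have hα : α₀ ∈ IntermediateField.adjoin k {α₀} := IntermediateField.mem_adjoin_simple_self k α₀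
  have hb : a⁻¹ * b ∈ IntermediateField.adjoin k {α₀} := by
    have : a⁻¹ * b ∈ Set.range (algebraMap (IntermediateField.adjoin k {α₀}) L) := by
      rw [InfiniteGalois.mem_range_algebraMap_iff_fixed]
      intro σ
      by_contra hσ
      have hσα : σ α₀ = α₀ := σ.commutes ⟨α₀, hα⟩
      refine hsimple (sq_dvd_aeval_X_zero_of_affine_factors (a' := σ a) (b' := σ b)
        (h' := MvPolynomial.map (σ : L →+* L) h) (fun hab => hσ ?_) ha hfactor ?_)
      · have hσa : σ a ≠ 0 := (map_ne_zero σ).mpr ha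
        rw [map_mul, map_inv₀]
        field_simp
        linear_combination hab
      · have hfix : MvPolynomial.map (σ : L →+* L) (MvPolynomial.map (algebraMap k L) f) =
            MvPolynomial.map (algebraMap k L) f := by
          rw [MvPolynomial.map_map]
          congr 1
          congr 1
          ext x
          exact (σ.restrictScalars k).commutes x
        rw [← hfix, hfactor]
        simp [hσα]
    obtain ⟨y, hy⟩ := this
    exact hy ▸ y.2
  refine ⟨a⁻¹, inv_ne_zero ha, fun m => ?_⟩
  have hcoeff : a⁻¹ * coeff m (C a * X 0 + C b * X 1 + C (-(a * α₀))) =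
      coeff m (X 0) + (a⁻¹ * b) * coeff m (X 1) - coeff m (C α₀) := by
    rw [← coeff_C_mul, ← coeff_C_mul, ← coeff_add, ← coeff_sub]
    congr 1
    have haC : (C a⁻¹ * C a : MvPolynomial (Fin 2) L) = 1 := by
      rw [← C_mul, inv_mul_cancel₀ ha, C_1]
    simp only [C_mul, C_neg]
    linear_combination (X 0 - C α₀) * haC
  rw [hcoeff]
  refine sub_mem (add_mem ?_ (mul_mem hb ?_)) ?_
  · rw [coeff_X]; split_ifs <;> simp
  · rw [coeff_X]; split_ifs <;> simp
  · rw [coeff_C]; split_ifs <;> simp [hα]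

/-- **Rationality of a linear factor through a simple point (from Proposition 2.1).**
Let `k` be a perfect field with algebraic closure `k̄`, and `f ∈ k[X,Y]` of total
degree `d` such that `f(X, 0) ∈ k[X]` has degree `d` and a simple root `α₀ ∈ k̄`
(i.e. `(X - α₀)` divides `f(X,0)` over `k̄` but `(X - α₀)²` does not). If
`f = g·h` over `k̄` with `g` of total degree 1 and `g(α₀, 0) = 0`, then some nonzero
scalar multiple of `g` has all its coefficients in the subfield `k(α₀)` of `k̄`. -/
theorem stmt6 (k : Type*) [Field k] [PerfectField k] (d : ℕ)
    (f : MvPolynomial (Fin 2) k) (hdeg : f.totalDegree = d)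
    (α₀ : AlgebraicClosure k)
    (hd0 : (MvPolynomial.aeval ![Polynomial.X, 0] f : Polynomial k).natDegree = d)
    (hroot : (Polynomial.X - Polynomial.C α₀) ∣
      (MvPolynomial.aeval ![Polynomial.X, 0] f : Polynomial k).map
        (algebraMap k (AlgebraicClosure k)))
    (hsimple : ¬ (Polynomial.X - Polynomial.C α₀) ^ 2 ∣
      (MvPolynomial.aeval ![Polynomial.X, 0] f : Polynomial k).map
        (algebraMap k (AlgebraicClosure k)))
    (g h : MvPolynomial (Fin 2) (AlgebraicClosure k))
    (hfactor : MvPolynomial.map (algebraMap k (AlgebraicClosure k)) f = g * h)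
    (hg1 : g.totalDegree = 1)
    (hgv : MvPolynomial.eval ![α₀, 0] g = 0) :
    ∃ c : AlgebraicClosure k, c ≠ 0 ∧
      ∀ m : Fin 2 →₀ ℕ,
        c * MvPolynomial.coeff m g ∈ IntermediateField.adjoin k {α₀} := by
  exact exists_mul_coeff_mem_adjoin_of_simple_root hsimple hfactor hg1.le hgv
end

section
/- Let k be a field with algebraic closure k̄, let n ≥ 2, and let f ∈ k[x₁,…,xₙ] be a polynomial of total degree d ≥ 2 having no factor of degree 1 in k̄[x₁,…,xₙ]. Fix v₁,…,vₙ, w₂,…,wₙ ∈ k such that the univariate polynomial f(X+v₁, w₂X+v₂, …, wₙX+vₙ) ∈ k[X] has degree d. Define χ = f(X+v₁, w₂X+Z₂Y+v₂, …, wₙX+ZₙY+vₙ) ∈ k[X,Y,Z₂,…,Zₙ]. Then χ has no divisor in k̄[X,Y,Z₂,…,Zₙ] of total degree exactly 1 in the variables X, Z₂, …, Zₙ; that is, no divisor of the form a(Y)·X + b₂(Y)·Z₂ + ⋯ + bₙ(Y)·Zₙ + c(Y) with a, b₂, …, bₙ, c ∈ k̄[Y] not all of a, b₂, …, bₙ zero.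 -/
open MvPolynomial

/-- The generic planar-slice polynomial
`χ = f(X + v₁, w₂X + Z₂Y + v₂, …, wₙX + ZₙY + vₙ) ∈ k[X, Y, Z₂, …, Zₙ]`.
The variables `X` and `Y` are `X (Sum.inl 0)` and `X (Sum.inl 1)`, and the
variables `Z₂, …, Zₙ` are `X (Sum.inr j)` for `j : Fin n`. -/
noncomputable def genericSlice {k : Type*} [CommSemiring k] {n : ℕ}
    (f : MvPolynomial (Fin (n + 1)) k) (v : Fin (n + 1) → k) (w : Fin n → k) :
    MvPolynomial (Fin 2 ⊕ Fin n) k :=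
  aeval (Fin.cases (X (Sum.inl 0) + C (v 0))
    (fun j => C (w j) * X (Sum.inl 0) + X (Sum.inr j) * X (Sum.inl 1) + C (v j.succ)) :
      Fin (n + 1) → MvPolynomial (Fin 2 ⊕ Fin n) k) f

/-- Specialize `Y` to `y` and, when `y ≠ 0`, undo the resulting invertible affine change of
variables `x₁ = X + v₁`, `xⱼ = wⱼX + yZⱼ + vⱼ`. -/
noncomputable def sliceInverse {K : Type*} [Field K] {n : ℕ} (v : Fin (n + 1) → K)
    (w : Fin n → K) (y : K) :
    MvPolynomial (Fin 2 ⊕ Fin n) K →ₐ[K] MvPolynomial (Fin (n + 1)) K :=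
  aeval (Sum.elim ![X 0 - C (v 0), C y]
    (fun j => C y⁻¹ * (X j.succ - C (w j) * (X 0 - C (v 0)) - C (v j.succ))))

theorem map_genericSlice {k K : Type*} [CommSemiring k] [CommSemiring K] (φ : k →+* K) {n : ℕ}
    (f : MvPolynomial (Fin (n + 1)) k) (v : Fin (n + 1) → k) (w : Fin n → k) :
    MvPolynomial.map φ (genericSlice f v w) =
      genericSlice (MvPolynomial.map φ f) (φ ∘ v) (φ ∘ w) := by
  induction f using MvPolynomial.induction_on with
  | C r => simp [genericSlice, algebraMap_eq]
  | add p q hp hq => simp_all [genericSlice]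
  | mul_X p i hp =>
    simp only [genericSlice, map_mul, aeval_X, map_X] at hp ⊢
    rw [hp]
    congr 1
    cases i using Fin.cases <;> simp

theorem sliceInverse_genericSlice {K : Type*} [Field K] {n : ℕ} (v : Fin (n + 1) → K)
    (w : Fin n → K) {y : K} (hy : y ≠ 0) (f : MvPolynomial (Fin (n + 1)) K) :
    sliceInverse v w y (genericSlice f v w) = f := by
  have h : (C y⁻¹ * C y : MvPolynomial (Fin (n + 1)) K) = 1 := by
    rw [← C_mul, inv_mul_cancel₀ hy, C_1]
  induction f using MvPolynomial.induction_on with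
  | C r => simp [genericSlice, algebraMap_eq, sliceInverse]
  | add p q hp hq => simp_all [genericSlice]
  | mul_X p i hp =>
    simp only [genericSlice, map_mul, aeval_X] at hp ⊢
    rw [hp]
    congr 1
    cases i using Fin.cases with
    | zero => simp [sliceInverse, algebraMap_eq]
    | succ j =>
      simp only [sliceInverse, Fin.cases_succ, map_add, map_mul, aeval_X, algHom_C,
        algebraMap_eq, Sum.elim_inl, Sum.elim_inr, Matrix.cons_val_zero, Matrix.cons_val_one]
      linear_combination (X j.succ - C (w j) * (X 0 - C (v 0)) - C (v j.succ)) * h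

theorem aeval_polynomial_aeval_X {R σ A : Type*} [CommSemiring R] [CommSemiring A] [Algebra R A]
    (φ : MvPolynomial σ R →ₐ[R] A) (i : σ) {y : R} (hi : φ (X i) = algebraMap R A y)
    (p : Polynomial R) :
    φ (Polynomial.aeval (X i : MvPolynomial σ R) p) = algebraMap R A (p.eval y) := by
  rw [← Polynomial.aeval_algHom_apply, hi, Polynomial.aeval_algebraMap_apply,
    Polynomial.coe_aeval_eq_eval]

theorem totalDegree_sliceInverse {K : Type*} [Field K] {n : ℕ} (v : Fin (n + 1) → K)
    (w : Fin n → K) {y : K} (hy : y ≠ 0) (a c : Polynomial K) (b : Fin n → Polynomial K)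
    (hab : a.eval y ≠ 0 ∨ ∃ j, (b j).eval y ≠ 0) :
    (sliceInverse v w y (Polynomial.aeval (X (Sum.inl 1)) a * X (Sum.inl 0) +
      ∑ j, Polynomial.aeval (X (Sum.inl 1)) (b j) * X (Sum.inr j) +
      Polynomial.aeval (X (Sum.inl 1)) c)).totalDegree = 1 := by
  have hY : sliceInverse v w y (X (Sum.inl 1)) = algebraMap K _ y := by
    simp [sliceInverse, algebraMap_eq]
  have key : sliceInverse v w y (Polynomial.aeval (X (Sum.inl 1)) a * X (Sum.inl 0) +
      ∑ j, Polynomial.aeval (X (Sum.inl 1)) (b j) * X (Sum.inr j) +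
      Polynomial.aeval (X (Sum.inl 1)) c) =
      C (a.eval y) * (X 0 - C (v 0)) + ∑ j, C ((b j).eval y) *
        (C y⁻¹ * (X j.succ - C (w j) * (X 0 - C (v 0)) - C (v j.succ))) + C (c.eval y) := by
    simp only [map_add, map_mul, map_sum, aeval_polynomial_aeval_X _ _ hY]
    simp [sliceInverse, algebraMap_eq]
  rw [key]
  have hC_mul : ∀ (r : K) (p : MvPolynomial (Fin (n + 1)) K), p.totalDegree ≤ 1 →
      (C r * p).totalDegree ≤ 1 := fun r p hp =>
    (totalDegree_mul _ _).trans (by simpa using hp)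
  have hadd : ∀ p q : MvPolynomial (Fin (n + 1)) K, p.totalDegree ≤ 1 → q.totalDegree ≤ 1 →
      (p + q).totalDegree ≤ 1 := fun p q hp hq =>
    (totalDegree_add _ _).trans (max_le hp hq)
  have hsub : ∀ p q : MvPolynomial (Fin (n + 1)) K, p.totalDegree ≤ 1 → q.totalDegree ≤ 1 →
      (p - q).totalDegree ≤ 1 := fun p q hp hq =>
    (totalDegree_sub _ _).trans (max_le hp hq)
  have hC : ∀ r : K, (C r : MvPolynomial (Fin (n + 1)) K).totalDegree ≤ 1 := by simp
  have hX : ∀ i, (X i : MvPolynomial (Fin (n + 1)) K).totalDegree ≤ 1 := by simp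
  have h0 := hsub _ _ (hX 0) (hC (v 0))
  refine le_antisymm (hadd _ _ (hadd _ _ (hC_mul _ _ h0) (totalDegree_finsetSum_le
    fun j _ => hC_mul _ _ (hC_mul _ _ (hsub _ _ (hsub _ _ (hX _) (hC_mul _ _ h0)) (hC _)))))
    (hC _)) (Nat.one_le_iff_ne_zero.2 fun h => ?_)
  rw [totalDegree_eq_zero_iff_eq_C] at h
  generalize coeff (R := K) (0 : Fin (n + 1) →₀ ℕ) _ = r at h
  have heval : ∀ (s : K) (t : Fin n → K),
      a.eval y * s + ∑ j, (b j).eval y * t j + c.eval y = r := fun s t => by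
    simpa [hy] using congrArg
      (eval (Fin.cases (s + v 0) fun j => w j * s + (y * t j + v j.succ) : Fin (n + 1) → K)) h
  have hc := heval 0 0
  simp only [mul_zero, Pi.zero_apply, Finset.sum_const_zero, zero_add] at hc
  rcases hab with ha | ⟨j, hj⟩
  · have := heval 1 0
    simp_all
  · have := heval 0 (Pi.single j 1)
    simp_all [Pi.single_apply]

/-- **First step of Theorem 2.4 (after Kaltofen's Lemma 5).**
If `f` has total degree `d ≥ 2` and no degree-one factor over the algebraic closure,
and the univariate polynomial `f(X+v₁, w₂X+v₂, …, wₙX+vₙ)` has degree `d`, then the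
generic planar-slice polynomial `χ` has no divisor over the algebraic closure of the
form `a(Y)·X + b₂(Y)·Z₂ + ⋯ + bₙ(Y)·Zₙ + c(Y)` with `a, b₂, …, bₙ, c ∈ k̄[Y]`
and `a, b₂, …, bₙ` not all zero. -/
theorem stmt7 (k : Type*) [Field k] (n d : ℕ) (hn : 1 ≤ n) (hd : 2 ≤ d)
    (f : MvPolynomial (Fin (n + 1)) k) (hdeg : f.totalDegree = d)
    (hnolin : ¬ ∃ g : MvPolynomial (Fin (n + 1)) (AlgebraicClosure k),
      g.totalDegree = 1 ∧ g ∣ MvPolynomial.map (algebraMap k (AlgebraicClosure k)) f)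
    (v : Fin (n + 1) → k) (w : Fin n → k)
    (hunideg : (lineSlice f v w).natDegree = d) :
    ¬ ∃ (g : MvPolynomial (Fin 2 ⊕ Fin n) (AlgebraicClosure k))
        (a c : Polynomial (AlgebraicClosure k))
        (b : Fin n → Polynomial (AlgebraicClosure k)),
      g ∣ MvPolynomial.map (algebraMap k (AlgebraicClosure k)) (genericSlice f v w) ∧
      g = Polynomial.aeval (X (Sum.inl 1) : MvPolynomial (Fin 2 ⊕ Fin n)
              (AlgebraicClosure k)) a * X (Sum.inl 0)
          + ∑ j : Fin n, Polynomial.aeval (X (Sum.inl 1) : MvPolynomial (Fin 2 ⊕ Fin n)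
              (AlgebraicClosure k)) (b j) * X (Sum.inr j)
          + Polynomial.aeval (X (Sum.inl 1) : MvPolynomial (Fin 2 ⊕ Fin n)
              (AlgebraicClosure k)) c ∧
      (a ≠ 0 ∨ ∃ j, b j ≠ 0) := by
  rintro ⟨g, a, c, b, hg, rfl, hab⟩
  obtain ⟨y, hy, hyab⟩ : ∃ y : AlgebraicClosure k,
      y ≠ 0 ∧ (a.eval y ≠ 0 ∨ ∃ j, (b j).eval y ≠ 0) := by
    have hp : ∀ p : Polynomial (AlgebraicClosure k), p ≠ 0 → ∃ y, y ≠ 0 ∧ p.eval y ≠ 0 := by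
      intro p hp
      by_contra! h
      refine mul_ne_zero Polynomial.X_ne_zero hp (Polynomial.funext fun y => ?_)
      by_cases hy : y = 0 <;> simp_all
    rcases hab with ha | ⟨j, hj⟩
    · exact (hp a ha).imp fun y h => ⟨h.1, Or.inl h.2⟩
    · exact (hp (b j) hj).imp fun y h => ⟨h.1, Or.inr ⟨j, h.2⟩⟩
  rw [map_genericSlice] at hg
  have hdvd := map_dvd (sliceInverse (algebraMap k (AlgebraicClosure k) ∘ v)
    (algebraMap k (AlgebraicClosure k) ∘ w) y) hg
  rw [sliceInverse_genericSlice _ _ hy] at hdvd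
  exact hnolin ⟨_, totalDegree_sliceInverse _ _ hy a c b hyab, hdvd⟩
end

section
/- Let q be a prime power and d ≥ 1 an integer with q ≥ d. Let m ≥ 1, let f ∈ 𝔽_q[x₀,…,x_m] be homogeneous of degree d, and let ℓ ∈ 𝔽_q[x₀,…,x_m] be a nonzero linear form. If f(a) = 0 for every a ∈ 𝔽_q^{m+1} with ℓ(a) = 0, then ℓ divides f in 𝔽_q[x₀,…,x_m]. -/
namespace MvPolynomial

/-- A linear form evaluates linearly. -/
theorem IsHomogeneous.eval_sub_smul_of_one {σ R : Type*} [CommRing R] {p : MvPolynomial σ R}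
    (hp : p.IsHomogeneous 1) (a v : σ → R) (t : R) :
    eval (a - t • v) p = eval a p - t * eval v p := by
  have hmem : p ∈ Submodule.span R (Set.range (X : σ → MvPolynomial σ R)) := by
    rw [← homogeneousSubmodule_one_eq_span_X]
    exact hp
  clear hp
  induction hmem using Submodule.span_induction with
  | mem x hx =>
    obtain ⟨i, rfl⟩ := hx
    simp
  | zero => simp
  | add x y _ _ hx hy =>
    rw [map_add, hx, hy, map_add, map_add]
    ring
  | smul r x _ hx =>
    simp only [smul_eval, hx]
    ring

/-- Substituting values congruent to the variables modulo `l` does not change a polynomial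
modulo `l`. -/
theorem dvd_sub_aeval {σ R : Type*} [CommRing R] {l : MvPolynomial σ R}
    {g : σ → MvPolynomial σ R} (hg : ∀ i, l ∣ X i - g i) (p : MvPolynomial σ R) :
    l ∣ p - aeval g p := by
  have h : (Ideal.Quotient.mkₐ R (Ideal.span {l})) =
      (Ideal.Quotient.mkₐ R (Ideal.span {l})).comp (aeval g) := by
    ext i
    simpa [Ideal.Quotient.mk_eq_mk_iff_sub_mem, Ideal.mem_span_singleton] using hg i
  rw [← Ideal.mem_span_singleton, ← Ideal.Quotient.mk_eq_mk_iff_sub_mem]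
  exact DFunLike.congr_fun h p

/-- A homogeneous polynomial whose degree is at most the cardinality of the field, and which
vanishes at all rational points of a hyperplane, is divisible by the equation of the hyperplane. -/
theorem IsHomogeneous.dvd_of_forall_eval_eq_zero_of_le_card {σ K : Type*} [Field K] {d : ℕ}
    {f l : MvPolynomial σ K} (hf : f.IsHomogeneous d) (hl : l.IsHomogeneous 1) (hl0 : l ≠ 0)
    (hd : (d : Cardinal) ≤ Cardinal.mk K) (h : ∀ a, eval a l = 0 → eval a f = 0) : l ∣ f := by
  obtain ⟨w, hw⟩ : ∃ w, eval w l ≠ 0 := by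
    by_contra! hw
    exact hl0 (hl.eq_zero_of_forall_eval_eq_zero_of_le_card hw
      (by simpa using Cardinal.one_le_iff_ne_zero.mpr (Cardinal.mk_ne_zero K)))
  -- Project onto the hyperplane along `w`.
  let g : σ → MvPolynomial σ K := fun i ↦ X i - C (w i / eval w l) * l
  have hg : ∀ i, (g i).IsHomogeneous 1 := fun i ↦ (isHomogeneous_X K i).sub (hl.C_mul _)
  have hzero : MvPolynomial.aeval g f = 0 := by
    refine IsHomogeneous.eq_zero_of_forall_eval_eq_zero_of_le_card
      (n := d) (by simpa using hf.aeval g hg) (fun a ↦ ?_) hd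
    have hpt : (fun i ↦ eval a (g i)) = a - (eval a l / eval w l) • w := by
      ext i
      simp only [g, map_sub, map_mul, eval_X, eval_C, Pi.sub_apply, Pi.smul_apply, smul_eq_mul]
      ring
    have hcomp : eval a (MvPolynomial.aeval g f) = eval (fun i ↦ eval a (g i)) f := by
      have hid : (eval a).comp (algebraMap K (MvPolynomial σ K)) = RingHom.id K := by
        ext r
        simp [algebraMap_eq]
      rw [map_aeval, hid]
      rfl
    rw [hcomp, hpt]
    apply h
    rw [hl.eval_sub_smul_of_one, div_mul_cancel₀ _ hw, sub_self]
  have hdvd := dvd_sub_aeval (g := g) (l := l) (fun i ↦ by simp [g]) f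
  rwa [hzero, sub_zero] at hdvd

end MvPolynomial

/-- **Consequence of Lemma 3.1.** If `q ≥ d ≥ 1`, `m ≥ 1`, `f` is homogeneous of
degree `d` in `m + 1` variables over `𝔽_q`, `ℓ` is a nonzero linear form, and `f`
vanishes at every `𝔽_q`-point of the hyperplane `ℓ = 0`, then `ℓ` divides `f`. -/
theorem stmt9 (q d m : ℕ) (hd : 1 ≤ d) (hqd : d ≤ q) (hm : 1 ≤ m)
    (F : Type*) [Field F] [Fintype F] (hq : Fintype.card F = q)
    (f : MvPolynomial (Fin (m + 1)) F) (hf : f.IsHomogeneous d)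
    (ℓ : MvPolynomial (Fin (m + 1)) F) (hℓ0 : ℓ ≠ 0) (hℓ : ℓ.IsHomogeneous 1)
    (hvanish : ∀ a : Fin (m + 1) → F,
      MvPolynomial.eval a ℓ = 0 → MvPolynomial.eval a f = 0) :
    ℓ ∣ f := by
  refine hf.dvd_of_forall_eval_eq_zero_of_le_card hℓ hℓ0 ?_ hvanish
  rw [Cardinal.mk_fintype, hq]
  exact_mod_cast hqd
end

section
/- Let q be a prime power with q ≥ 7, let m ≥ 2, and let f ∈ 𝔽_q[x₀,…,x_m] be a nonzero homogeneous polynomial of degree 7 with hypersurface X_f ⊂ P^m. Let U and V be distinct linear subvarieties of P^m of dimension s ≥ 0, defined over 𝔽_q, both contained in X_f, with dim(U ∩ V) = s−1. Then at least one of the following holds: (i) a restriction f|_{⟨U,V⟩} ∈ 𝔽_q[y₀,…,y_{s+1}] has an irreducible factor g ∈ 𝔽_q[y₀,…,y_{s+1}] of degree at most 3 which is irreducible in 𝔽̄_q[y₀,…,y_{s+1}] and whose square does not divide f|_{⟨U,V⟩}; (ii) there exists a linear subvariety W ⊆ ⟨U,V⟩ (possibly empty) of dimension at most s, defined over 𝔽_q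 and contained in X_f, such that every 𝔽_q-point of X_f ∩ ⟨U,V⟩ lies in U ∪ V ∪ W; (iii) ⟨U,V⟩ ⊆ X_f. -/
open MvPolynomial

/-- The restriction of a polynomial `f` in `m + 1` variables to the linear subspace
spanned by the vectors `e 0, …, e (r-1)`: the polynomial in `r` variables
`y ↦ f (∑ j, y j • e j)`. -/
noncomputable def linRestrict {F : Type*} [CommSemiring F] {m r : ℕ}
    (f : MvPolynomial (Fin (m + 1)) F) (e : Fin r → (Fin (m + 1) → F)) :
    MvPolynomial (Fin r) F :=
  aeval (fun i => ∑ j, C (e j i) * X j) f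

namespace MvPolynomial

section HomogeneousFactor

variable {σ R : Type*} [CommRing R]

/-- The grading of `MvPolynomial σ R` by total degree, recorded by an extra variable:
`p ↦ ∑ i, (homogeneousComponent i p) T ^ i`. -/
noncomputable def scaleVars : MvPolynomial σ R →ₐ[R] Polynomial (MvPolynomial σ R) :=
  aeval fun i => Polynomial.C (X i) * Polynomial.X

lemma scaleVars_monomial (d : σ →₀ ℕ) (r : R) :
    scaleVars (monomial d r) = Polynomial.monomial d.degree (monomial d r) := by
  rw [scaleVars, aeval_monomial, Finsupp.prod]
  simp_rw [mul_pow]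
  rw [Finset.prod_mul_distrib, Finset.prod_pow_eq_pow_sum, ← Polynomial.C_mul_X_pow_eq_monomial,
    monomial_eq, Finsupp.prod, Finsupp.degree_apply, Polynomial.C_mul, map_prod]
  simp [mul_assoc, Polynomial.algebraMap_apply, MvPolynomial.algebraMap_eq]

lemma coeff_scaleVars (p : MvPolynomial σ R) (j : ℕ) :
    (scaleVars p).coeff j = homogeneousComponent j p := by
  induction p using MvPolynomial.induction_on' with
  | monomial d r =>
    rw [scaleVars_monomial, Polynomial.coeff_monomial,
      homogeneousComponent_of_mem (isHomogeneous_monomial r rfl)]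
    simp [eq_comm]
  | add p q hp hq => rw [map_add, map_add, Polynomial.coeff_add, hp, hq]

lemma scaleVars_injective : Function.Injective (scaleVars (σ := σ) (R := R)) := by
  intro p q h
  ext d
  have := congrArg (fun P => coeff d (P.coeff d.degree)) h
  simpa [coeff_scaleVars, coeff_homogeneousComponent] using this

theorem IsHomogeneous.of_mul_left [IsDomain R] {a b : MvPolynomial σ R} {k : ℕ}
    (h : (a * b).IsHomogeneous k) (hab : a * b ≠ 0) : a.IsHomogeneous a.totalDegree := by
  suffices H : ∃ i, a.IsHomogeneous i by
    obtain ⟨i, hi⟩ := H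
    rwa [hi.totalDegree (left_ne_zero_of_mul hab)]
  have ha : scaleVars a ≠ 0 := by
    simpa using scaleVars_injective.ne (left_ne_zero_of_mul hab)
  have hb : scaleVars b ≠ 0 := by
    simpa using scaleVars_injective.ne (right_ne_zero_of_mul hab)
  have hm : scaleVars a * scaleVars b = Polynomial.monomial k (a * b) := by
    rw [← map_mul]
    ext1 j
    rw [coeff_scaleVars, homogeneousComponent_of_mem h, Polynomial.coeff_monomial]
    simp [eq_comm]
  have h1 := congrArg Polynomial.natDegree hm
  have h2 := congrArg Polynomial.natTrailingDegree hm
  rw [Polynomial.natDegree_mul ha hb, Polynomial.natDegree_monomial_eq _ hab] at h1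
  rw [Polynomial.natTrailingDegree_mul ha hb, Polynomial.natTrailingDegree_monomial hab] at h2
  have h3 := (scaleVars a).natTrailingDegree_le_natDegree
  have h4 := (scaleVars b).natTrailingDegree_le_natDegree
  refine ⟨(scaleVars a).natDegree, fun d hd => ?_⟩
  have h5 : (scaleVars a).coeff d.degree ≠ 0 := by
    intro h0
    rw [coeff_scaleVars] at h0
    apply hd
    simpa [coeff_homogeneousComponent] using congrArg (coeff d) h0
  have h6 := Polynomial.le_natDegree_of_ne_zero h5
  have h7 := Polynomial.natTrailingDegree_le_of_ne_zero h5
  rw [Finsupp.degree_eq_weight_one] at h6 h7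
  change Finsupp.weight (fun _ => 1) d = _
  lia

end HomogeneousFactor

section LinForm

variable {σ R : Type*} [Fintype σ] [CommRing R]

/-- The linear form with coefficient vector `c`. -/
noncomputable def linForm (c : σ → R) : MvPolynomial σ R := ∑ i, C (c i) * X i

@[simp] lemma eval_linForm (c v : σ → R) : eval v (linForm c) = c ⬝ᵥ v := by
  simp [linForm, dotProduct]

lemma map_linForm {S : Type*} [CommRing S] (φ : R →+* S) (c : σ → R) :
    map φ (linForm c) = linForm (φ ∘ c) := by
  simp [linForm]

lemma coeff_linForm (c : σ → R) (i : σ) : coeff (Finsupp.single i 1) (linForm c) = c i := by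
  classical
  simp [linForm, coeff_sum, coeff_C_mul, coeff_X, Finsupp.single_left_inj]

lemma linForm_injective : Function.Injective (linForm : (σ → R) → MvPolynomial σ R) := by
  intro c d h
  funext i
  rw [← coeff_linForm c, h, coeff_linForm]

lemma linForm_ne_zero {c : σ → R} (hc : c ≠ 0) : linForm c ≠ 0 := by
  have := linForm_injective.ne hc
  simpa [linForm] using this

lemma isHomogeneous_linForm (c : σ → R) : (linForm c).IsHomogeneous 1 :=
  IsHomogeneous.sum _ _ _ fun i _ => isHomogeneous_C_mul_X (c i) i

lemma IsHomogeneous.exists_eq_linForm {p : MvPolynomial σ R} (hp : p.IsHomogeneous 1) :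
    ∃ c, p = linForm c := by
  classical
  rw [← mem_homogeneousSubmodule, homogeneousSubmodule_one_eq_span_X,
    Submodule.mem_span_range_iff_exists_fun] at hp
  obtain ⟨c, rfl⟩ := hp
  exact ⟨c, by simp [linForm, smul_eq_C_mul]⟩

lemma irreducible_linForm {K : Type*} [Field K] {c : σ → K} (hc : c ≠ 0) :
    Irreducible (linForm c) := by
  refine irreducible_of_totalDegree_eq_one
    ((isHomogeneous_linForm c).totalDegree (linForm_ne_zero hc)) fun x hx => ?_
  obtain ⟨i, hi⟩ := Function.ne_iff.1 hc
  have := hx (Finsupp.single i 1)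
  rw [coeff_linForm] at this
  exact isUnit_of_dvd_unit this (isUnit_iff_ne_zero.2 hi)

lemma linForm_dvd_of_forall_eval_eq_zero {K : Type*} [Field K] {p : MvPolynomial σ K} {k : ℕ}
    (hp : p.IsHomogeneous k) (hk : (k : Cardinal) ≤ Cardinal.mk K) {c : σ → K} (hc : c ≠ 0)
    (h : ∀ v, c ⬝ᵥ v = 0 → eval v p = 0) : linForm c ∣ p := by
  classical
  obtain ⟨i, hi⟩ := Function.ne_iff.1 hc
  set w : σ → K := Pi.single i (c i)⁻¹ with hw
  have hcw : c ⬝ᵥ w = 1 := by simp [hw, mul_inv_cancel₀ hi]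
  set g : σ → MvPolynomial σ K := fun j => X j - C (w j) * linForm c with hg
  have h0 : aeval g p = 0 := by
    have hhom : (aeval g p).IsHomogeneous k := by
      simpa using hp.aeval g (n := 1) fun j =>
        (isHomogeneous_X K j).sub ((isHomogeneous_linForm c).C_mul (w j))
    refine hhom.eq_zero_of_forall_eval_eq_zero_of_le_card (fun v => ?_) hk
    have : eval v (aeval g p) = eval (fun j => eval v (g j)) p := by
      have := eval₂Hom_bind₁ (RingHom.id K) v g p
      exact this
    rw [this]
    apply h
    have : (fun j => eval v (g j)) = v - (c ⬝ᵥ v) • w := by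
      funext j
      simp [hg, mul_comm]
    rw [this, dotProduct_sub, dotProduct_smul, hcw]
    simp
  rw [← Ideal.mem_span_singleton, ← Ideal.Quotient.eq_zero_iff_mem]
  set I := Ideal.span {linForm c}
  have hI : Ideal.Quotient.mk I (linForm c) = 0 :=
    Ideal.Quotient.eq_zero_iff_mem.2 (Ideal.mem_span_singleton_self _)
  have : (Ideal.Quotient.mkₐ K I).comp (aeval g) = Ideal.Quotient.mkₐ K I := by
    ext j
    simp [hg, hI]
  have := DFunLike.congr_fun this p
  rw [AlgHom.comp_apply, h0, map_zero] at this
  exact this.symm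

lemma exists_smul_eq_of_linForm_dvd {K : Type*} [Field K] {c d : σ → K} (hd : d ≠ 0)
    (h : linForm c ∣ linForm d) : ∃ a : K, d = a • c := by
  obtain ⟨r, hr⟩ := h
  have hne : linForm c * r ≠ 0 := hr ▸ linForm_ne_zero hd
  have hdeg := congrArg totalDegree hr
  rw [totalDegree_mul_of_isDomain (left_ne_zero_of_mul hne) (right_ne_zero_of_mul hne),
    (isHomogeneous_linForm d).totalDegree (linForm_ne_zero hd),
    (isHomogeneous_linForm c).totalDegree (left_ne_zero_of_mul hne)] at hdeg
  rw [totalDegree_eq_zero_iff_eq_C.1 (show r.totalDegree = 0 by lia)] at hr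
  refine ⟨coeff 0 r, ?_⟩
  funext i
  rw [← coeff_linForm d, hr, mul_comm, coeff_C_mul, coeff_linForm, Pi.smul_apply, smul_eq_mul]

end LinForm

section Descent

variable {σ K L : Type*} [Fintype σ] [Field K] [Field L] [Algebra K L] [IsGalois K L]

lemma exists_map_eq_of_forall_map_eq {σ : Type*} {p : MvPolynomial σ L}
    (h : ∀ τ : Gal(L/K), map (τ : L →+* L) p = p) : ∃ p₀, map (algebraMap K L) p₀ = p := by
  change p ∈ Set.range (map (algebraMap K L))
  rw [mem_range_map_iff_coeffs_subset]
  intro x hx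
  obtain ⟨d, -, rfl⟩ := mem_coeffs_iff.1 hx
  rw [InfiniteGalois.mem_range_algebraMap_iff_fixed]
  intro τ
  have := congrArg (coeff d) (h τ)
  rwa [coeff_map] at this

lemma finite_orbit_galois (c : σ → L) : (Set.range fun τ : Gal(L/K) => τ ∘ c).Finite := by
  refine (Set.Finite.pi' fun i => (minpoly K (c i)).rootSet_finite L).subset ?_
  rintro _ ⟨τ, rfl⟩ i
  rw [Polynomial.mem_rootSet]
  refine ⟨minpoly.ne_zero (Algebra.IsIntegral.isIntegral _), ?_⟩
  have := Polynomial.aeval_algHom_apply (τ : L →ₐ[K] L) (c i) (minpoly K (c i))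
  simpa using this

/-- The zeros over `K` of an irreducible polynomial over `K` which acquires a linear factor over a
Galois extension are the common zeros of a linear form with coefficients in the extension. -/
theorem eval_eq_zero_iff_of_linForm_dvd_map {g : MvPolynomial σ K} (hg : Irreducible g)
    {c : σ → L} (hc : c ≠ 0) (h : linForm c ∣ map (algebraMap K L) g) (v : σ → K) :
    eval v g = 0 ↔ c ⬝ᵥ (algebraMap K L ∘ v) = 0 := by
  classical
  have heval (p : MvPolynomial σ K) :
      eval (algebraMap K L ∘ v) (map (algebraMap K L) p) = algebraMap K L (eval v p) := by
    rw [eval_map, eval₂_comp]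
  constructor
  swap
  · intro hv
    obtain ⟨r, hr⟩ := h
    have := heval g
    rw [hr, map_mul, eval_linForm, hv, zero_mul] at this
    exact (map_eq_zero _).1 this.symm
  wlog hone : ∃ i, c i = 1 generalizing c
  · obtain ⟨i, hi⟩ := Function.ne_iff.1 hc
    have hi' : c i ≠ 0 := hi
    have hu : linForm ((c i)⁻¹ • c) = C (c i)⁻¹ * linForm c := by
      simp [linForm, Finset.mul_sum, mul_assoc]
    have := this (c := (c i)⁻¹ • c) (smul_ne_zero (inv_ne_zero hi') hc) ?_
      ⟨i, by simp [hi']⟩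
    · simpa [smul_dotProduct, hi'] using this
    · have hC : IsUnit (C (c i)⁻¹ : MvPolynomial σ L) :=
        (isUnit_iff_ne_zero.2 (inv_ne_zero hi')).map C
      rwa [hu, hC.mul_left_dvd]
  obtain ⟨i, hi⟩ := hone
  set O := (finite_orbit_galois (K := K) c).toFinset with hO
  have hmem (d : σ → L) : d ∈ O ↔ ∃ τ : Gal(L/K), τ ∘ c = d := by simp [hO]
  have hOi : ∀ d ∈ O, d i = 1 := by
    intro d hd
    obtain ⟨τ, rfl⟩ := (hmem d).1 hd
    simp [hi]
  have hO0 : ∀ d ∈ O, d ≠ 0 := by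
    rintro d hd rfl
    simpa using hOi _ hd
  set P : MvPolynomial σ L := ∏ d ∈ O, linForm d with hP
  have hP0 : P ≠ 0 := Finset.prod_ne_zero_iff.2 fun d hd => linForm_ne_zero (hO0 d hd)
  have hgτ (τ : Gal(L/K)) :
      map (τ : L →+* L) (map (algebraMap K L) g) = map (algebraMap K L) g := by
    rw [map_map]
    congr 2
    ext x
    simp
  have hPτ (τ : Gal(L/K)) : map (τ : L →+* L) P = P := by
    rw [hP, map_prod]
    refine Finset.prod_bij (fun d _ => τ ∘ d) ?_ ?_ ?_ ?_
    · intro d hd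
      obtain ⟨τ', rfl⟩ := (hmem d).1 hd
      exact (hmem _).2 ⟨τ * τ', rfl⟩
    · intro d _ d' _ hdd
      exact τ.injective.comp_left hdd
    · intro d hd
      obtain ⟨τ', rfl⟩ := (hmem d).1 hd
      refine ⟨(τ⁻¹ * τ' : Gal(L/K)) ∘ c, (hmem _).2 ⟨_, rfl⟩, ?_⟩
      funext j
      exact τ.apply_symm_apply _
    · intro d _
      exact map_linForm _ d
  have hPg : P ∣ map (algebraMap K L) g := by
    refine Finset.prod_dvd_of_isRelPrime ?_ ?_
    · intro d hd d' hd' hne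
      refine (irreducible_linForm (hO0 d hd)).isRelPrime_iff_not_dvd.2 fun hdvd => hne ?_
      obtain ⟨a, rfl⟩ := exists_smul_eq_of_linForm_dvd (hO0 d' hd') hdvd
      have := hOi _ hd'
      rw [Pi.smul_apply, hOi d hd, smul_eq_mul, mul_one] at this
      rw [this, one_smul]
    · intro d hd
      obtain ⟨τ, rfl⟩ := (hmem d).1 hd
      have := map_dvd (map (τ : L →+* L)) h
      rw [hgτ, map_linForm] at this
      exact this
  obtain ⟨Q, hQ⟩ := hPg
  obtain ⟨P₀, hP₀⟩ := exists_map_eq_of_forall_map_eq (K := K) hPτ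
  obtain ⟨Q₀, hQ₀⟩ := exists_map_eq_of_forall_map_eq (K := K) (p := Q) fun τ => by
    apply mul_left_cancel₀ hP0
    rw [← hQ, ← hgτ τ, hQ, map_mul, hPτ]
  have hfac : g = P₀ * Q₀ := by
    apply map_injective _ (algebraMap K L).injective
    rw [map_mul, hP₀, hQ₀, hQ]
  have hcO : c ∈ O := (hmem c).2 ⟨1, rfl⟩
  have hP₀u : ¬ IsUnit P₀ := by
    intro hu
    have := hu.map (map (algebraMap K L))
    rw [hP₀] at this
    exact (irreducible_linForm hc).not_isUnit
      (isUnit_of_dvd_unit (Finset.dvd_prod_of_mem linForm hcO) this)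
  have hQ₀u := (hg.isUnit_or_isUnit hfac).resolve_left hP₀u
  intro hv
  rw [hfac, map_mul] at hv
  have hv := (mul_eq_zero.1 hv).resolve_right (hQ₀u.map (eval v)).ne_zero
  have hv := congrArg (algebraMap K L) hv
  rw [← heval, hP₀, hP, map_prod, map_zero, Finset.prod_eq_zero_iff] at hv
  obtain ⟨d, hd, hdv⟩ := hv
  obtain ⟨τ, rfl⟩ := (hmem d).1 hd
  rw [eval_linForm] at hdv
  apply τ.injective
  rw [map_zero, ← hdv]
  simp [dotProduct]

/-- The rational zeros of an irreducible polynomial which acquires a linear factor over a Galois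
extension form a proper subspace. -/
theorem exists_submodule_eval_eq_zero_iff {g : MvPolynomial σ K} (hg : Irreducible g)
    {c : σ → L} (hc : c ≠ 0) (h : linForm c ∣ map (algebraMap K L) g) :
    ∃ W : Submodule K (σ → K), W ≠ ⊤ ∧ ∀ v, eval v g = 0 ↔ v ∈ W := by
  classical
  refine ⟨LinearMap.ker (Fintype.linearCombination K c), fun htop => hc ?_, fun v => ?_⟩
  · funext i
    have : Pi.single i 1 ∈ LinearMap.ker (Fintype.linearCombination K c) := htop ▸ trivial
    simpa [Fintype.linearCombination_apply_single] using this
  · rw [eval_eq_zero_iff_of_linForm_dvd_map hg hc h, LinearMap.mem_ker,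
      Fintype.linearCombination_apply]
    simp [dotProduct, Algebra.smul_def, mul_comm]

end Descent

section LowDegree

variable {σ K : Type*} [Field K]

lemma isUnit_of_totalDegree_eq_zero {p : MvPolynomial σ K} (hp0 : p ≠ 0)
    (hp : p.totalDegree = 0) : IsUnit p := by
  rw [totalDegree_eq_zero_iff_eq_C.1 hp] at hp0 ⊢
  exact (isUnit_iff_ne_zero.2 fun h => hp0 (by rw [h, C_0])).map C

lemma totalDegree_pos_of_irreducible {p : MvPolynomial σ K} (hp : Irreducible p) :
    0 < p.totalDegree :=
  Nat.pos_of_ne_zero fun h =>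
    hp.not_isUnit (isUnit_of_totalDegree_eq_zero hp.ne_zero h)

/-- A form of degree at most 3 which is linear or reducible has a linear factor. -/
lemma IsHomogeneous.exists_linForm_dvd [Fintype σ] {p : MvPolynomial σ K} {k : ℕ} (hp : p.IsHomogeneous k)
    (hk0 : k ≠ 0) (hk : k ≤ 3) (hp0 : p ≠ 0) (h : k = 1 ∨ ¬ Irreducible p) :
    ∃ c : σ → K, c ≠ 0 ∧ linForm c ∣ p := by
  suffices H : ∃ a, a ∣ p ∧ a.totalDegree = 1 by
    obtain ⟨a, ⟨b, rfl⟩, ha⟩ := H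
    obtain ⟨c, rfl⟩ := (ha ▸ hp.of_mul_left hp0).exists_eq_linForm
    refine ⟨c, ?_, dvd_mul_right _ _⟩
    rintro rfl
    simp [linForm] at ha
  obtain rfl | h := h
  · exact ⟨p, dvd_rfl, hp.totalDegree hp0⟩
  have hdeg := hp.totalDegree hp0
  have hpu : ¬ IsUnit p := fun hu => by
    have := (isUnit_iff_totalDegree_of_isReduced.1 hu).2
    lia
  simp only [irreducible_iff, hpu, not_false_eq_true, true_and, not_forall, not_or] at h
  obtain ⟨a, b, rfl, ha, hb⟩ := h
  have ha0 := left_ne_zero_of_mul hp0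
  have hb0 := right_ne_zero_of_mul hp0
  rw [totalDegree_mul_of_isDomain ha0 hb0] at hdeg
  have h1 : a.totalDegree ≠ 0 := fun h => ha (isUnit_of_totalDegree_eq_zero ha0 h)
  have h2 : b.totalDegree ≠ 0 := fun h => hb (isUnit_of_totalDegree_eq_zero hb0 h)
  obtain h | h : a.totalDegree = 1 ∨ b.totalDegree = 1 := by lia
  · exact ⟨a, dvd_mul_right _ _, h⟩
  · exact ⟨b, dvd_mul_left _ _, h⟩

end LowDegree

section DegreeSeven

lemma exists_irreducible_dvd_eval_eq_zero {σ K : Type*} [Field K] {p : MvPolynomial σ K}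
    (hp : p ≠ 0) {v : σ → K} (hv : eval v p = 0) :
    ∃ g, Irreducible g ∧ g ∣ p ∧ eval v g = 0 := by
  obtain ⟨s, hs, u, rfl⟩ := UniqueFactorizationMonoid.exists_prime_factors p hp
  rw [map_mul] at hv
  have hv := (mul_eq_zero.1 hv).resolve_right (u.isUnit.map (eval v)).ne_zero
  rw [map_multiset_prod, Multiset.prod_eq_zero_iff, Multiset.mem_map] at hv
  obtain ⟨g, hg, hgv⟩ := hv
  exact ⟨g, (hs g hg).irreducible, (Multiset.dvd_prod hg).mul_right _, hgv⟩

variable {σ K : Type*} [Fintype σ] [Field K] [Finite K]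

/-- A form of degree 7 divisible by two different linear forms, whose absolutely irreducible
factors of degree at most 3 are all multiple, has its zeros in three proper subspaces. -/
theorem exists_submodule_of_forall_sq_dvd {p : MvPolynomial σ K} (hp : p.IsHomogeneous 7)
    (hp0 : p ≠ 0) {c₁ c₂ : σ → K} (hc₁ : c₁ ≠ 0) (hc₂ : c₂ ≠ 0)
    (hc : ¬ linForm c₁ ∣ linForm c₂) (h₁ : linForm c₁ ∣ p) (h₂ : linForm c₂ ∣ p)
    (H : ∀ g : MvPolynomial σ K, Irreducible g → g.totalDegree ≤ 3 →
      Irreducible (map (algebraMap K (AlgebraicClosure K)) g) → g ∣ p → g ^ 2 ∣ p) :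
    ∃ W : Submodule K (σ → K), W ≠ ⊤ ∧ (∀ v ∈ W, eval v p = 0) ∧
      ∀ v, eval v p = 0 → c₁ ⬝ᵥ v = 0 ∨ c₂ ⬝ᵥ v = 0 ∨ v ∈ W := by
  classical
  have hinj := (algebraMap K (AlgebraicClosure K)).injective
  have hlin {c : σ → K} (hc : c ≠ 0) (h : linForm c ∣ p) : linForm c ^ 2 ∣ p := by
    refine H _ (irreducible_linForm hc) ?_ ?_ h
    · rw [(isHomogeneous_linForm c).totalDegree (linForm_ne_zero hc)]
      lia
    · rw [map_linForm]
      refine irreducible_linForm fun h0 => hc (hinj.comp_left ?_)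
      simpa using h0
  have hirr₁ := irreducible_linForm hc₁
  have hirr₂ := irreducible_linForm hc₂
  have hrel := hirr₁.isRelPrime_iff_not_dvd.2 hc
  obtain ⟨k, hk⟩ := (hrel.pow (m := 2) (n := 2)).mul_dvd (hlin hc₁ h₁) (hlin hc₂ h₂)
  have hl0 : linForm c₁ ^ 2 * linForm c₂ ^ 2 ≠ 0 :=
    mul_ne_zero (pow_ne_zero _ hirr₁.ne_zero) (pow_ne_zero _ hirr₂.ne_zero)
  have hk0 : k ≠ 0 := right_ne_zero_of_mul (hk ▸ hp0)
  have hkhom : k.IsHomogeneous k.totalDegree := by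
    rw [hk, mul_comm] at hp
    exact hp.of_mul_left (by rwa [mul_comm, ← hk])
  have hkdeg : k.totalDegree = 3 := by
    have hl : (linForm c₁ ^ 2 * linForm c₂ ^ 2).IsHomogeneous (1 * 2 + 1 * 2) :=
      ((isHomogeneous_linForm c₁).pow 2).mul ((isHomogeneous_linForm c₂).pow 2)
    have := hp.totalDegree hp0
    rw [hk, totalDegree_mul_of_isDomain hl0 hk0, hl.totalDegree hl0] at this
    lia
  have hkp : k ∣ p := ⟨_, hk.trans (mul_comm _ _)⟩
  -- factors of `k` other than the two linear forms
  set S : Set (MvPolynomial σ K) :=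
    {g | Irreducible g ∧ g ∣ k ∧ ¬ g ∣ linForm c₁ ∧ ¬ g ∣ linForm c₂} with hS
  have hdeg {g} (hg : g ∈ S) : g.totalDegree ≤ 3 :=
    hkdeg ▸ totalDegree_le_of_dvd_of_isDomain hg.2.1 hk0
  have hsq {g} (hg : g ∈ S) (hmap : Irreducible (map (algebraMap K (AlgebraicClosure K)) g)) :
      g ^ 2 ∣ k := by
    have hdvd := H g hg.1 (hdeg hg) hmap (hg.2.1.trans hkp)
    rw [hk] at hdvd
    exact (((hg.1.isRelPrime_iff_not_dvd.2 hg.2.2.1).pow).mul_right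
      ((hg.1.isRelPrime_iff_not_dvd.2 hg.2.2.2).pow)).dvd_of_dvd_mul_left hdvd
  have hhom {g} (hg : g ∈ S) : g.IsHomogeneous g.totalDegree := by
    obtain ⟨r, rfl⟩ := hg.2.1
    exact hkhom.of_mul_left hk0
  have hone {g} (hg : g ∈ S) : g.totalDegree = 1 ∨
      ¬ Irreducible (map (algebraMap K (AlgebraicClosure K)) g) := by
    by_contra! hcon
    have := totalDegree_le_of_dvd_of_isDomain (hsq hg hcon.2) hk0
    rw [(hhom hg |>.pow 2).totalDegree (pow_ne_zero _ hg.1.ne_zero)] at this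
    have := totalDegree_pos_of_irreducible hg.1
    lia
  have hpow {g} (hg : g ∈ S) : ∃ n, g ^ n ∣ k ∧ 2 ≤ (g ^ n).totalDegree := by
    have hpos := totalDegree_pos_of_irreducible hg.1
    by_cases hg1 : g.totalDegree = 1
    · have hh := hhom hg
      rw [hg1] at hh
      obtain ⟨c, rfl⟩ := hh.exists_eq_linForm
      refine ⟨2, hsq hg ?_, ?_⟩
      · rw [map_linForm]
        refine irreducible_linForm fun h0 => hg.1.ne_zero ?_
        apply map_injective _ hinj
        rw [map_linForm, h0]
        simp [linForm]
      · rw [(hh.pow 2).totalDegree (pow_ne_zero _ hg.1.ne_zero)]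
    · refine ⟨1, by simpa using hg.2.1, ?_⟩
      rw [pow_one]
      lia
  have huniq {g g'} (hg : g ∈ S) (hg' : g' ∈ S) : g ∣ g' := by
    by_contra hcon
    obtain ⟨n, hn, hn2⟩ := hpow hg
    obtain ⟨n', hn', hn2'⟩ := hpow hg'
    have hdvd := ((hg.1.isRelPrime_iff_not_dvd.2 hcon).pow (m := n) (n := n')).mul_dvd hn hn'
    have := totalDegree_le_of_dvd_of_isDomain hdvd hk0
    rw [totalDegree_mul_of_isDomain (pow_ne_zero _ hg.1.ne_zero)
      (pow_ne_zero _ hg'.1.ne_zero)] at this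
    lia
  have hzero {g q : MvPolynomial σ K} {v : σ → K} (hgq : g ∣ q) (hv : eval v g = 0) :
      eval v q = 0 := by
    obtain ⟨r, rfl⟩ := hgq
    rw [map_mul, hv, zero_mul]
  have hW : ∃ W : Submodule K (σ → K), W ≠ ⊤ ∧ (∀ v ∈ W, eval v p = 0) ∧
      ∀ g ∈ S, ∀ v, eval v g = 0 → v ∈ W := by
    obtain hemp | ⟨g, hg⟩ := S.eq_empty_or_nonempty
    · refine ⟨⊥, fun hbt => ?_, ?_, by simp [hemp]⟩
      · exact hc₁ ((Submodule.mem_bot K).1 (hbt ▸ Submodule.mem_top))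
      · rintro v hv
        rw [(Submodule.mem_bot K).1 hv]
        exact hzero h₁ (by rw [eval_linForm, dotProduct_zero])
    · obtain ⟨c, hc, hdvd⟩ := ((hhom hg).map (algebraMap K (AlgebraicClosure K))).exists_linForm_dvd
        (totalDegree_pos_of_irreducible hg.1).ne' (hdeg hg)
        (fun h0 => hg.1.ne_zero (map_injective _ hinj (by rw [h0, map_zero]))) (hone hg)
      obtain ⟨W, hWtop, hW⟩ := exists_submodule_eval_eq_zero_iff hg.1 hc hdvd
      refine ⟨W, hWtop, fun v hv => hzero (hg.2.1.trans hkp) ((hW v).2 hv), ?_⟩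
      exact fun g' hg' v hv => (hW v).1 (hzero (huniq hg' hg) hv)
  obtain ⟨W, hWtop, hWp, hWS⟩ := hW
  refine ⟨W, hWtop, hWp, fun v hv => ?_⟩
  by_contra! hcon
  rw [← eval_linForm, ← eval_linForm] at hcon
  rw [hk, map_mul, map_mul, map_pow, map_pow] at hv
  have hkv := (mul_eq_zero.1 hv).resolve_left
    (mul_ne_zero (pow_ne_zero _ hcon.1) (pow_ne_zero _ hcon.2.1))
  obtain ⟨g, hg, hgk, hgv⟩ := exists_irreducible_dvd_eval_eq_zero hk0 hkv
  exact hcon.2.2 (hWS g ⟨hg, hgk, fun h => hcon.1 (hzero h hgv), fun h => hcon.2.1 (hzero h hgv)⟩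
    v hgv)

end DegreeSeven

end MvPolynomial

lemma eval_linRestrict {F : Type*} [CommRing F] {m r : ℕ} (f : MvPolynomial (Fin (m + 1)) F)
    (e : Fin r → (Fin (m + 1) → F)) (y : Fin r → F) :
    eval y (linRestrict f e) = eval (Fintype.linearCombination F e y) f := by
  have : eval y (linRestrict f e) = _ :=
    eval₂Hom_bind₁ (RingHom.id F) y (fun i => ∑ j, C (e j i) * X j) f
  rw [this]
  change eval _ f = _
  congr 2
  funext i
  simp [Fintype.linearCombination_apply, mul_comm]

lemma isHomogeneous_linRestrict {F : Type*} [CommRing F] {m r k : ℕ}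
    {f : MvPolynomial (Fin (m + 1)) F} (hf : f.IsHomogeneous k)
    (e : Fin r → (Fin (m + 1) → F)) : (linRestrict f e).IsHomogeneous k := by
  have := hf.aeval (fun i => ∑ j, C (e j i) * X j) (n := 1) fun i =>
    IsHomogeneous.sum _ _ _ fun j _ => isHomogeneous_C_mul_X (e j i) j
  rwa [one_mul] at this

/-- A hyperplane of `K ^ n` is the kernel of a linear form. -/
lemma Submodule.exists_dotProduct_eq_zero_iff {K : Type*} [Field K] {n : ℕ}
    (W : Submodule K (Fin (n + 1) → K)) (hW : Module.finrank K W = n) :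
    ∃ c : Fin (n + 1) → K, c ≠ 0 ∧ ∀ v, v ∈ W ↔ c ⬝ᵥ v = 0 := by
  have hlt : W < ⊤ := by
    refine lt_top_iff_ne_top.2 fun h => ?_
    rw [h, finrank_top] at hW
    simp at hW
  obtain ⟨φ, hφ, hle⟩ := W.exists_le_ker_of_lt_top hlt
  have hker : W = LinearMap.ker φ := by
    refine Submodule.eq_of_le_of_finrank_le hle ?_
    have := Submodule.finrank_lt (s := LinearMap.ker φ) (by rwa [Ne, LinearMap.ker_eq_top])
    rw [Module.finrank_fin_fun] at this
    lia
  have hdot (v) : φ v = (fun i => φ (Pi.single i 1)) ⬝ᵥ v := by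
    conv_lhs => rw [pi_eq_sum_univ' v]
    simp [dotProduct, mul_comm]
  refine ⟨fun i => φ (Pi.single i 1), ?_, fun v => ?_⟩
  · intro h0
    refine hφ (LinearMap.ext fun v => ?_)
    rw [hdot, h0]
    simp
  · rw [hker, LinearMap.mem_ker, hdot]

/-- **Lemma 3.2.** Let `q ≥ 7`, `m ≥ 2`, and `f` a nonzero degree-7 form in `m + 1`
variables over `𝔽_q` with hypersurface `X_f`. Let `U, V` be distinct linear
subvarieties of `P^m` of projective dimension `s` (i.e. the projectivizations of
subspaces `U, V ⊆ 𝔽_q^{m+1}` of dimension `s + 1`) contained in `X_f`, with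
`dim (U ∩ V) = s - 1`. Let `e` be a basis of the span `⟨U, V⟩ = U ⊔ V`, giving a
restriction `f|_{⟨U,V⟩} = linRestrict f e` in `s + 2` variables. Then (i)
`f|_{⟨U,V⟩}` has an absolutely irreducible factor over `𝔽_q` of degree at most 3
and multiplicity 1, or (ii) there is a linear `W ⊆ ⟨U,V⟩` of projective dimension
at most `s` contained in `X_f` such that every `𝔽_q`-point of `X_f ∩ ⟨U,V⟩` lies
in `U ∪ V ∪ W`, or (iii) `⟨U,V⟩ ⊆ X_f`. -/
theorem stmt10 (q m s : ℕ) (hq7 : 7 ≤ q) (hm : 2 ≤ m)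
    (F : Type*) [Field F] [Fintype F] (hq : Fintype.card F = q)
    (f : MvPolynomial (Fin (m + 1)) F) (hf0 : f ≠ 0) (hf : f.IsHomogeneous 7)
    (U V : Submodule F (Fin (m + 1) → F))
    (hUV : U ≠ V)
    (hU : Module.finrank F U = s + 1) (hV : Module.finrank F V = s + 1)
    (hUVint : Module.finrank F ↥(U ⊓ V) = s)
    (hUf : ∀ x ∈ U, MvPolynomial.eval x f = 0)
    (hVf : ∀ x ∈ V, MvPolynomial.eval x f = 0)
    (e : Fin (s + 2) → (Fin (m + 1) → F))
    (he : LinearIndependent F e)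
    (hspan : Submodule.span F (Set.range e) = U ⊔ V) :
    -- (i)
    (∃ g : MvPolynomial (Fin (s + 2)) F,
        Irreducible g ∧ g.totalDegree ≤ 3 ∧
        Irreducible (MvPolynomial.map (algebraMap F (AlgebraicClosure F)) g) ∧
        g ∣ linRestrict f e ∧ ¬ g ^ 2 ∣ linRestrict f e) ∨
    -- (ii)
    (∃ W : Submodule F (Fin (m + 1) → F),
        W ≤ U ⊔ V ∧ Module.finrank F W ≤ s + 1 ∧
        (∀ x ∈ W, MvPolynomial.eval x f = 0) ∧
        (∀ x ∈ U ⊔ V, MvPolynomial.eval x f = 0 → x ∈ U ∨ x ∈ V ∨ x ∈ W)) ∨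
    -- (iii)
    (∀ x ∈ U ⊔ V, MvPolynomial.eval x f = 0) := by
  set p := linRestrict f e with hp
  set φ := Fintype.linearCombination F e with hφ
  have hφinj : Function.Injective φ :=
    linearIndependent_iff_injective_fintypeLinearCombination.1 he
  have hrange : LinearMap.range φ = U ⊔ V := by
    rw [hφ, Fintype.range_linearCombination, hspan]
  have hphom : p.IsHomogeneous 7 := isHomogeneous_linRestrict hf e
  have hsurj : ∀ x ∈ U ⊔ V, ∃ y, φ y = x := fun x hx => by
    rwa [← hrange] at hx
  by_cases hp0 : p = 0
  · refine Or.inr (Or.inr fun x hx => ?_)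
    obtain ⟨y, rfl⟩ := hsurj x hx
    rw [← eval_linRestrict, ← hp, hp0, map_zero]
  by_cases hi : ∃ g : MvPolynomial (Fin (s + 2)) F,
        Irreducible g ∧ g.totalDegree ≤ 3 ∧
        Irreducible (MvPolynomial.map (algebraMap F (AlgebraicClosure F)) g) ∧
        g ∣ p ∧ ¬ g ^ 2 ∣ p
  · exact Or.inl hi
  refine Or.inr (Or.inl ?_)
  have hcard : ((7 : ℕ) : Cardinal) ≤ Cardinal.mk F := by
    rw [Cardinal.mk_fintype, hq]
    exact_mod_cast hq7
  have hhyp (T : Submodule F (Fin (m + 1) → F)) (hT : Module.finrank F T = s + 1)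
      (hTle : T ≤ U ⊔ V) (hTf : ∀ x ∈ T, MvPolynomial.eval x f = 0) :
      ∃ c : Fin (s + 2) → F, c ≠ 0 ∧ (∀ y, φ y ∈ T ↔ c ⬝ᵥ y = 0) ∧ linForm c ∣ p := by
    have hmap : (T.comap φ).map φ = T := Submodule.map_comap_eq_self (hrange ▸ hTle)
    have hfin : Module.finrank F (T.comap φ) = s + 1 := by
      rw [(Submodule.equivMapOfInjective φ hφinj _).finrank_eq, hmap, hT]
    obtain ⟨c, hc, hcT⟩ := Submodule.exists_dotProduct_eq_zero_iff _ hfin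
    refine ⟨c, hc, hcT, linForm_dvd_of_forall_eval_eq_zero hphom hcard hc fun y hy => ?_⟩
    rw [eval_linRestrict]
    exact hTf _ ((hcT y).2 hy)
  obtain ⟨c₁, hc₁, hU', h₁⟩ := hhyp U hU le_sup_left hUf
  obtain ⟨c₂, hc₂, hV', h₂⟩ := hhyp V hV le_sup_right hVf
  have hne : ¬ linForm c₁ ∣ linForm c₂ := by
    intro hdvd
    obtain ⟨a, rfl⟩ := exists_smul_eq_of_linForm_dvd hc₂ hdvd
    refine hUV (Submodule.eq_of_le_of_finrank_eq (fun x hx => ?_) (hU.trans hV.symm))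
    obtain ⟨y, rfl⟩ := hsurj x (le_sup_left (a := U) (b := V) hx)
    rw [hV', smul_dotProduct, (hU' y).1 hx, smul_zero]
  push Not at hi
  obtain ⟨W, hWtop, hWp, hW⟩ :=
    exists_submodule_of_forall_sq_dvd hphom hp0 hc₁ hc₂ hne h₁ h₂ hi
  refine ⟨W.map φ, ?_, ?_, ?_, ?_⟩
  · exact hrange ▸ LinearMap.map_le_range
  · have := Submodule.finrank_lt hWtop
    rw [Module.finrank_fin_fun] at this
    rw [← (Submodule.equivMapOfInjective φ hφinj _).finrank_eq]
    lia
  · rintro _ ⟨y, hy, rfl⟩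
    rw [← eval_linRestrict]
    exact hWp y hy
  · intro x hx hxf
    obtain ⟨y, rfl⟩ := hsurj x hx
    rw [← eval_linRestrict] at hxf
    rw [hU', hV']
    exact (hW y hxf).imp_right (Or.imp_right fun h => Submodule.mem_map_of_mem h)
end

section
/- Let q be a prime power with q > 39, let m ≥ 2, and let f ∈ 𝔽_q[x₀,…,x_m] be a nonzero homogeneous polynomial of degree 7 with hypersurface X_f ⊂ P^m. Let U and V be distinct linear subvarieties of P^m of dimension s ≥ 1, defined over 𝔽_q, both contained in X_f, with dim(U ∩ V) = s−1. Then at least one of the following holds: (i) X_f has a smooth 𝔽_q-point; (ii) there exists a linear subvariety W ⊆ ⟨U,V⟩ (possibly empty) of dimension at most s, defined over 𝔽_q and contained in X_f, such that every 𝔽_q-point of X_f ∩ ⟨U,V⟩ lies in U ∪ V ∪ W; (iii) ⟨U,V⟩ ⊆ X_f. -/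
/-- The univariate polynomial `f (a + X b)`: the restriction of `f` to a parametrized line. -/
noncomputable def MvPolynomial.restrictLine {σ F K : Type*} [CommRing F] [CommRing K] [Algebra F K]
    (f : MvPolynomial σ F) (a b : σ → K) : Polynomial K :=
  MvPolynomial.aeval (fun i => Polynomial.C (a i) + Polynomial.C (b i) * Polynomial.X) f

namespace MvPolynomial

section CommRing

variable {σ F K : Type*} [CommRing F] [CommRing K] [Algebra F K]

lemma restrictLine_eval_aeval (f : MvPolynomial σ F) (a b : σ → K) (t : K) :
    (f.restrictLine a b).eval t = aeval (a + t • b) f := by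
  have h : (Polynomial.aeval (R := K) t : Polynomial K →ₐ[K] K).restrictScalars F
      (f.restrictLine a b) = aeval (a + t • b) f := by
    rw [restrictLine, ← AlgHom.comp_apply, comp_aeval]
    congr 2
    ext i
    simp [mul_comm (b i)]
  simpa [Polynomial.coe_aeval_eq_eval] using h

lemma eval_restrictLine (f : MvPolynomial σ F) (a b : σ → F) (t : F) :
    (f.restrictLine a b).eval t = eval (a + t • b) f :=
  restrictLine_eval_aeval f a b t

lemma restrictLine_coeff_zero (f : MvPolynomial σ F) (a b : σ → K) :
    (f.restrictLine a b).coeff 0 = aeval a f := by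
  simp [Polynomial.coeff_zero_eq_eval_zero, restrictLine_eval_aeval]

lemma restrictLine_coeff_one [Fintype σ] (f : MvPolynomial σ F) (a b : σ → K) :
    (f.restrictLine a b).coeff 1 = ∑ i, b i * aeval a (pderiv i f) := by
  classical
  induction f using MvPolynomial.induction_on with
  | C c => simp [restrictLine, Polynomial.algebraMap_apply]
  | add p q hp hq =>
    have : (p + q).restrictLine a b = p.restrictLine a b + q.restrictLine a b := map_add _ _ _
    simp only [this, Polynomial.coeff_add, hp, hq, map_add, mul_add, Finset.sum_add_distrib]
  | mul_X p j hp =>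
    have : (p * MvPolynomial.X j).restrictLine a b =
        p.restrictLine a b * (Polynomial.C (a j) + Polynomial.C (b j) * Polynomial.X) := by
      simp [restrictLine]
    rw [this, mul_add, Polynomial.coeff_add, Polynomial.coeff_mul_C, ← mul_assoc,
      Polynomial.coeff_mul_X, Polynomial.coeff_mul_C, hp, restrictLine_coeff_zero]
    have h (i : σ) : b i * aeval a (pderiv i (p * MvPolynomial.X j)) =
        b i * aeval a (pderiv i p) * a j + if i = j then b i * aeval a p else 0 := by
      rw [pderiv_mul, pderiv_X]
      by_cases hij : i = j
      · subst hij; simp; ring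
      · simp [hij, Ne.symm hij]; ring
    simp only [h, Finset.sum_add_distrib, Finset.sum_mul, Finset.sum_ite_eq', Finset.mem_univ,
      if_true]
    ring

lemma X_sq_dvd_restrictLine [Fintype σ] {f : MvPolynomial σ F} {a : σ → K} (b : σ → K)
    (h0 : aeval a f = 0) (h1 : ∀ i, aeval a (pderiv i f) = 0) :
    Polynomial.X ^ 2 ∣ f.restrictLine a b := by
  rw [Polynomial.X_pow_dvd_iff]
  intro d hd
  interval_cases d
  · rw [restrictLine_coeff_zero, h0]
  · rw [restrictLine_coeff_one]
    simp [h1]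

lemma restrictLine_comp (f : MvPolynomial σ F) (a b : σ → K) (t : K) :
    (f.restrictLine (a + t • b) b).comp (Polynomial.X - Polynomial.C t) = f.restrictLine a b := by
  have h : ((Polynomial.aeval (R := K) (Polynomial.X - Polynomial.C t) :
      Polynomial K →ₐ[K] Polynomial K).restrictScalars F)
      (f.restrictLine (a + t • b) b) = f.restrictLine a b := by
    rw [restrictLine, ← AlgHom.comp_apply, comp_aeval, restrictLine]
    congr 2
    ext1 i
    simp
    ring
  simpa [Polynomial.aeval_def, Polynomial.comp] using h

lemma X_sub_C_pow_dvd_restrictLine {f : MvPolynomial σ F} {a b : σ → K} {t : K} {n : ℕ}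
    (h : Polynomial.X ^ n ∣ f.restrictLine (a + t • b) b) :
    (Polynomial.X - Polynomial.C t) ^ n ∣ f.restrictLine a b := by
  obtain ⟨g, hg⟩ := h
  rw [← restrictLine_comp f a b t, hg]
  simp

lemma natDegree_restrictLine_le [Nontrivial F] {f : MvPolynomial σ F} {d : ℕ}
    (hf : f.totalDegree ≤ d) (a b : σ → F) : (f.restrictLine a b).natDegree ≤ d := by
  have := aeval_natDegree_le (n := 1) f hf
    (fun i => Polynomial.C (a i) + Polynomial.C (b i) * Polynomial.X) fun i => by
    rw [add_comm]; exact Polynomial.natDegree_linear_le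
  simpa [restrictLine] using this

lemma IsHomogeneous.eval_smul_eq {f : MvPolynomial σ F} {d : ℕ} (hf : f.IsHomogeneous d) (c : F)
    (a : σ → F) : eval (c • a) f = c ^ d * eval a f := by
  rw [eval_eq, eval_eq, Finset.mul_sum]
  refine Finset.sum_congr rfl fun m hm => ?_
  have hd := hf (mem_support_iff.mp hm)
  simp only [Pi.smul_apply, smul_eq_mul, mul_pow, Finset.prod_mul_distrib]
  rw [Finset.prod_pow_eq_pow_sum]
  have : ∑ i ∈ m.support, m i = d := by
    rw [← hd, Finsupp.weight_apply, Finsupp.sum]; simp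
  rw [this]; ring

end CommRing

section Field

variable {σ F : Type*} [Field F]

/-- A form vanishing to order two at `b` has small degree along lines of direction `b`. -/
lemma IsHomogeneous.natDegree_restrictLine_le_of_sq_dvd [Fintype F] {f : MvPolynomial σ F} {d : ℕ}
    (hf : f.IsHomogeneous (d + 2)) (hd : d + 3 < Fintype.card F) {a b : σ → F}
    (h : Polynomial.X ^ 2 ∣ f.restrictLine b a) : (f.restrictLine a b).natDegree ≤ d := by
  classical
  obtain ⟨g, hg⟩ := h
  have hgd : g.natDegree ≤ d := by
    rcases eq_or_ne g 0 with rfl | hg0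
    · simp
    have := natDegree_restrictLine_le hf.totalDegree_le b a
    rw [hg, Polynomial.natDegree_X_pow_mul _ hg0] at this
    omega
  have key : f.restrictLine a b - g.reflect d = 0 := by
    refine Polynomial.eq_zero_of_natDegree_lt_card_of_eval_eq_zero' _ (Finset.univ.erase (0 : F))
      ?_ ?_
    · intro t ht
      have ht0 : t ≠ 0 := (Finset.mem_erase.mp ht).1
      let := invertibleOfNonzero (inv_ne_zero ht0)
      have h1 : g.eval t⁻¹ * t ^ d = (g.reflect d).eval t := by
        have := Polynomial.eval₂_reflect_mul_pow (RingHom.id F) t⁻¹ d g hgd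
        simp only [invOf_eq_inv, inv_inv] at this
        rw [Polynomial.eval, Polynomial.eval, ← this, mul_assoc, ← mul_pow, inv_mul_cancel₀ ht0,
          one_pow, mul_one]
      have h2 : a + t • b = t • (b + t⁻¹ • a) := by
        rw [smul_add, smul_smul, mul_inv_cancel₀ ht0, one_smul, add_comm]
      rw [Polynomial.eval_sub, eval_restrictLine, h2, hf.eval_smul_eq, ← h1, ← eval_restrictLine, hg]
      simp
      field_simp
      ring
    · rw [Finset.card_erase_of_mem (Finset.mem_univ _), Finset.card_univ]
      have h1 := Polynomial.natDegree_sub_le (f.restrictLine a b) (g.reflect d)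
      have h2 := natDegree_restrictLine_le hf.totalDegree_le a b
      have h3 := Polynomial.natDegree_reflect_le (N := d) (p := g)
      have h4 := max_le h2 (h3.trans (max_le (Nat.le_add_right d 2) (hgd.trans (by omega))))
      omega
  rw [sub_eq_zero.mp key]
  exact Polynomial.natDegree_reflect_le.trans (max_le le_rfl hgd)

lemma restrictLine_eq_zero [Fintype F] {f : MvPolynomial σ F} (hf : f.totalDegree < Fintype.card F)
    {a b : σ → F} (h : ∀ t : F, eval (a + t • b) f = 0) : f.restrictLine a b = 0 := by
  refine Polynomial.eq_zero_of_natDegree_lt_card_of_eval_eq_zero _ (f := id)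
    Function.injective_id (fun t => ?_) ((natDegree_restrictLine_le le_rfl a b).trans_lt hf)
  rw [restrictLine_eval_aeval]
  exact h t

/-- The two-variable restriction `f (r + x a + y b)`, as a polynomial in `y` over `F[x]`. -/
noncomputable def restrictPlane (f : MvPolynomial σ F) (r a b : σ → F) :
    Polynomial (Polynomial F) :=
  f.restrictLine (fun i => Polynomial.C (r i) + Polynomial.C (a i) * Polynomial.X)
    (fun i => Polynomial.C (b i))

lemma swap_restrictPlane (f : MvPolynomial σ F) (r a b : σ → F) :
    Polynomial.Bivariate.swap (f.restrictPlane r a b) = f.restrictPlane r b a := by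
  rw [restrictPlane, restrictLine, restrictPlane, restrictLine]
  change (Polynomial.Bivariate.swap (R := F)).toAlgHom _ = _
  rw [← AlgHom.comp_apply, comp_aeval]
  congr 2
  ext1 i
  simp [Polynomial.Bivariate.swap_X, Polynomial.Bivariate.swap_Y, Polynomial.Bivariate.swap_C_C]
  ring

lemma eval_X_restrictPlane (f : MvPolynomial σ F) (r a b : σ → F) :
    (f.restrictPlane r a b).eval Polynomial.X = f.restrictLine r (a + b) := by
  rw [restrictPlane, restrictLine_eval_aeval, restrictLine]
  congr 2
  ext1 i
  simp
  ring

lemma X_sq_dvd_restrictPlane [Fintype σ] [Fintype F] {f : MvPolynomial σ F} {d : ℕ}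
    (hf : f.IsHomogeneous d) (hd : d < Fintype.card F) {r a : σ → F} (b : σ → F)
    (h0 : ∀ t : F, eval (r + t • a) f = 0)
    (h1 : ∀ t : F, ∀ i, eval (r + t • a) (pderiv i f) = 0) :
    Polynomial.X ^ 2 ∣ f.restrictPlane r a b := by
  refine X_sq_dvd_restrictLine _ (restrictLine_eq_zero (hf.totalDegree_le.trans_lt hd) h0) fun i =>
    restrictLine_eq_zero ?_ fun t => h1 t i
  exact (hf.pderiv.totalDegree_le.trans (Nat.sub_le d 1)).trans_lt hd

/-- If `f` vanishes doubly along two lines through `r`, it vanishes to order four at `r`. -/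
lemma X_pow_four_dvd_restrictLine [Fintype σ] [Fintype F] {f : MvPolynomial σ F} {d : ℕ}
    (hf : f.IsHomogeneous d) (hd : d < Fintype.card F) {r a b : σ → F}
    (h : ∀ x, eval x f = 0 → ∀ i, eval x (pderiv i f) = 0)
    (ha : ∀ t : F, eval (r + t • a) f = 0) (hb : ∀ t : F, eval (r + t • b) f = 0) :
    Polynomial.X ^ 4 ∣ f.restrictLine r (a + b) := by
  obtain ⟨g, hg⟩ := X_sq_dvd_restrictPlane hf hd b ha fun t => h _ (ha t)
  obtain ⟨k, hk⟩ := X_sq_dvd_restrictPlane hf hd a hb fun t => h _ (hb t)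
  have hdvd : Polynomial.C (Polynomial.X ^ 2) ∣ f.restrictPlane r a b := by
    refine ⟨Polynomial.Bivariate.swap k, ?_⟩
    rw [← swap_restrictPlane, hk, map_mul, map_pow, Polynomial.Bivariate.swap_Y, map_pow]
  have hg' : Polynomial.C (Polynomial.X ^ 2) ∣ g := by
    rw [Polynomial.C_dvd_iff_dvd_coeff] at hdvd ⊢
    intro n
    have := hdvd (n + 2)
    rwa [hg, mul_comm, Polynomial.coeff_mul_X_pow] at this
  obtain ⟨e, he⟩ := hg'
  rw [← eval_X_restrictPlane, hg, he]
  refine ⟨e.eval Polynomial.X, ?_⟩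
  simp
  ring

end Field

end MvPolynomial

open MvPolynomial in
/-- If all rational zeros of `f` are singular, a line joining two rational zeros off `U ∪ V` lies
in the hypersurface. -/
lemma eval_add_smul_eq_zero_of_singular {σ F : Type*} [Fintype σ] [Field F] [Fintype F]
    (hF : 8 < Fintype.card F) {f : MvPolynomial σ F} (hf : f.IsHomogeneous 7)
    {U V : Submodule F (σ → F)} (hUf : ∀ x ∈ U, eval x f = 0) (hVf : ∀ x ∈ V, eval x f = 0)
    (hsing : ∀ x, eval x f = 0 → ∀ i, eval x (pderiv i f) = 0)
    (hU : ∀ x ∈ U ⊔ V, x ∉ U → ∀ y ∈ U ⊔ V, ∃ t : F, y + t • x ∈ U)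
    (hV : ∀ x ∈ U ⊔ V, x ∉ V → ∀ y ∈ U ⊔ V, ∃ t : F, y + t • x ∈ V)
    {a b : σ → F} (ha : a ∈ U ⊔ V) (haU : a ∉ U) (haV : a ∉ V) (haf : eval a f = 0)
    (hb : b ∈ U ⊔ V) (hbU : b ∉ U) (hbV : b ∉ V) (hbf : eval b f = 0) (t : F) :
    eval (a + t • b) f = 0 := by
  have dbl (x y : σ → F) (hx : eval x f = 0) : Polynomial.X ^ 2 ∣ f.restrictLine x y :=
    X_sq_dvd_restrictLine y hx (hsing x hx)
  have hdeg : (f.restrictLine a b).natDegree ≤ 5 :=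
    hf.natDegree_restrictLine_le_of_sq_dvd hF (dbl b a hbf)
  obtain ⟨u, hu⟩ := hU b hb hbU a ha
  obtain ⟨v, hv⟩ := hV b hb hbV a ha
  have hu0 : u ≠ 0 := by rintro rfl; simp [haU] at hu
  have hv0 : v ≠ 0 := by rintro rfl; simp [haV] at hv
  have h0 : (Polynomial.X - Polynomial.C 0) ^ 2 ∣ f.restrictLine a b := by
    simpa using dbl a b haf
  have cop (x y : F) (hxy : x ≠ y) (m n : ℕ) :
      IsCoprime ((Polynomial.X - Polynomial.C x) ^ m) ((Polynomial.X - Polynomial.C y) ^ n) :=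
    (Polynomial.isCoprime_X_sub_C_of_isUnit_sub (sub_ne_zero.mpr hxy).isUnit).pow
  suffices f.restrictLine a b = 0 by
    have h := restrictLine_eval_aeval f a b t
    rw [this] at h
    simpa using h.symm
  by_contra hne
  by_cases huv : u = v
  · subst huv
    obtain ⟨c, hc, d, hd, hcd⟩ := Submodule.mem_sup.mp hb
    have h4 : (Polynomial.X - Polynomial.C u) ^ 4 ∣ f.restrictLine a b := by
      apply X_sub_C_pow_dvd_restrictLine
      have := X_pow_four_dvd_restrictLine hf (by omega)
        (r := a + u • b) (a := c) (b := d) hsing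
        (fun s => hUf _ (U.add_mem hu (U.smul_mem s hc)))
        (fun s => hVf _ (V.add_mem hv (V.smul_mem s hd)))
      rwa [hcd] at this
    have := Polynomial.natDegree_le_of_dvd ((cop 0 u hu0.symm 2 4).mul_dvd h0 h4) hne
    rw [Polynomial.natDegree_mul (pow_ne_zero _ (Polynomial.X_sub_C_ne_zero _))
      (pow_ne_zero _ (Polynomial.X_sub_C_ne_zero _)), Polynomial.natDegree_pow,
      Polynomial.natDegree_pow, Polynomial.natDegree_X_sub_C, Polynomial.natDegree_X_sub_C] at this
    omega
  · have h1 := X_sub_C_pow_dvd_restrictLine (dbl _ b (hUf _ hu))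
    have h2 := X_sub_C_pow_dvd_restrictLine (dbl _ b (hVf _ hv))
    have := Polynomial.natDegree_le_of_dvd (((cop 0 v hv0.symm 2 2).mul_left
      (cop u v huv 2 2)).mul_dvd ((cop 0 u hu0.symm 2 2).mul_dvd h0 h1) h2) hne
    rw [← mul_pow, ← mul_pow, Polynomial.natDegree_pow,
      Polynomial.natDegree_mul (mul_ne_zero (Polynomial.X_sub_C_ne_zero _)
      (Polynomial.X_sub_C_ne_zero _)) (Polynomial.X_sub_C_ne_zero _),
      Polynomial.natDegree_mul (Polynomial.X_sub_C_ne_zero _) (Polynomial.X_sub_C_ne_zero _)] at this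
    simp only [Polynomial.natDegree_X_sub_C] at this
    omega

/-- A line in direction `x ∉ H` meets a hyperplane `H`. -/
lemma exists_add_smul_mem_of_finrank {F M : Type*} [Field F] [AddCommGroup M] [Module F M]
    [FiniteDimensional F M] {H L : Submodule F M} (hHL : H ≤ L)
    (hL : Module.finrank F L ≤ Module.finrank F H + 1) {x : M} (hx : x ∈ L) (hxH : x ∉ H)
    {y : M} (hy : y ∈ L) : ∃ t : F, y + t • x ∈ H := by
  have hlt : H < H ⊔ Submodule.span F {x} := by
    refine lt_of_le_of_ne le_sup_left fun h => hxH ?_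
    rw [h]
    exact Submodule.mem_sup_right (Submodule.mem_span_singleton_self x)
  have hle : H ⊔ Submodule.span F {x} ≤ L :=
    sup_le hHL ((Submodule.span_singleton_le_iff_mem _ _).mpr hx)
  have heq := Submodule.eq_of_le_of_finrank_le hle
    (hL.trans (Submodule.finrank_lt_finrank_of_lt hlt))
  rw [← heq] at hy
  obtain ⟨h, hh, z, hz, rfl⟩ := Submodule.mem_sup.mp hy
  obtain ⟨c, rfl⟩ := Submodule.mem_span_singleton.mp hz
  exact ⟨-c, by simpa using hh⟩

open MvPolynomial in
/-- A polynomial of small degree vanishing at all but two points of a line vanishes on it. -/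
lemma eval_eq_zero_of_forall_notMem {σ F : Type*} [Field F] [Fintype F]
    {f : MvPolynomial σ F} (hf : f.totalDegree + 2 < Fintype.card F) {U V : Submodule F (σ → F)}
    {x y z : σ → F} (hyU : y ∉ U) (hyV : y ∉ V)
    (h : ∀ t : F, x + t • y ∉ U → x + t • y ∉ V → eval (x + t • y + z) f = 0) :
    eval (x + z) f = 0 := by
  classical
  have sub (H : Submodule F (σ → F)) (hy : y ∉ H) :
      (Finset.univ.filter fun t : F => x + t • y ∈ H).card ≤ 1 := by
    rw [Finset.card_le_one]
    intro s hs t ht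
    by_contra hst
    have := H.sub_mem (Finset.mem_filter.mp hs).2 (Finset.mem_filter.mp ht).2
    rw [add_sub_add_left_eq_sub, ← sub_smul, H.smul_mem_iff (sub_ne_zero.mpr hst)] at this
    exact hy this
  set S := (Finset.univ.filter fun t : F => x + t • y ∈ U) ∪
    Finset.univ.filter fun t : F => x + t • y ∈ V with hS
  have hScard : S.card ≤ 2 := (Finset.card_union_le _ _).trans (add_le_add (sub U hyU) (sub V hyV))
  have hzero : f.restrictLine (x + z) y = 0 := by
    refine Polynomial.eq_zero_of_natDegree_lt_card_of_eval_eq_zero' _ Sᶜ (fun t ht => ?_) ?_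
    · rw [restrictLine_eval_aeval, add_right_comm]
      simp only [hS, Finset.mem_compl, Finset.mem_union, Finset.mem_filter, Finset.mem_univ,
        true_and, not_or] at ht
      exact h t ht.1 ht.2
    · have h1 := natDegree_restrictLine_le (le_refl f.totalDegree) (x + z) y
      rw [Finset.card_compl]
      omega
  have := restrictLine_coeff_zero f (x + z) y
  rw [hzero] at this
  simpa using this.symm


/-- **Lemma 3.4.** Let `q > 39`, `m ≥ 2`, and `f` a nonzero degree-7 form in `m + 1`
variables over `𝔽_q` with hypersurface `X_f`. Let `U, V` be distinct linear
subvarieties of `P^m` of projective dimension `s ≥ 1` (projectivizations of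
subspaces of dimension `s + 1`) contained in `X_f`, with `dim (U ∩ V) = s - 1`.
Then (i) `X_f` has a smooth `𝔽_q`-point, or (ii) there is a linear `W ⊆ ⟨U,V⟩` of
projective dimension at most `s` contained in `X_f` such that every `𝔽_q`-point of
`X_f ∩ ⟨U,V⟩` lies in `U ∪ V ∪ W`, or (iii) `⟨U,V⟩ ⊆ X_f`. -/
theorem stmt11 (q m s : ℕ) (hq39 : 39 < q) (hm : 2 ≤ m) (hs : 1 ≤ s)
    (F : Type*) [Field F] [Fintype F] (hq : Fintype.card F = q)
    (f : MvPolynomial (Fin (m + 1)) F) (hf0 : f ≠ 0) (hf : f.IsHomogeneous 7)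
    (U V : Submodule F (Fin (m + 1) → F))
    (hUV : U ≠ V)
    (hU : Module.finrank F U = s + 1) (hV : Module.finrank F V = s + 1)
    (hUVint : Module.finrank F ↥(U ⊓ V) = s)
    (hUf : ∀ x ∈ U, MvPolynomial.eval x f = 0)
    (hVf : ∀ x ∈ V, MvPolynomial.eval x f = 0) :
    -- (i) a smooth 𝔽_q-point of X_f
    (∃ a : Fin (m + 1) → F, a ≠ 0 ∧ MvPolynomial.eval a f = 0 ∧
        ∃ i, MvPolynomial.eval a (MvPolynomial.pderiv i f) ≠ 0) ∨
    -- (ii)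
    (∃ W : Submodule F (Fin (m + 1) → F),
        W ≤ U ⊔ V ∧ Module.finrank F W ≤ s + 1 ∧
        (∀ x ∈ W, MvPolynomial.eval x f = 0) ∧
        (∀ x ∈ U ⊔ V, MvPolynomial.eval x f = 0 → x ∈ U ∨ x ∈ V ∨ x ∈ W)) ∨
    -- (iii)
    (∀ x ∈ U ⊔ V, MvPolynomial.eval x f = 0) := by
  subst hq
  by_cases hsm : ∃ a : Fin (m + 1) → F, a ≠ 0 ∧ MvPolynomial.eval a f = 0 ∧
      ∃ i, MvPolynomial.eval a (MvPolynomial.pderiv i f) ≠ 0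
  · exact Or.inl hsm
  right
  push Not at hsm
  have hsing : ∀ x, MvPolynomial.eval x f = 0 →
      ∀ i, MvPolynomial.eval x (MvPolynomial.pderiv i f) = 0 := by
    intro x hx i
    rcases eq_or_ne x 0 with rfl | hx0
    · have := (hf.pderiv (i := i)).eval_smul_eq 0 0
      simpa using this
    · exact hsm x hx0 hx i
  have hL := Submodule.finrank_sup_add_finrank_inf_eq U V
  by_cases hS : ∃ p ∈ U ⊔ V, p ∉ U ∧ p ∉ V ∧ MvPolynomial.eval p f = 0
  swap
  · push Not at hS
    left
    refine ⟨⊥, bot_le, by simp, fun x hx => hUf x ?_, fun x hx hxf => ?_⟩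
    · rw [(Submodule.mem_bot F).mp hx]; exact U.zero_mem
    · by_contra! hc
      exact hS x hx hc.1 hc.2.1 hxf
  obtain ⟨p, hpL, hpU, hpV, hpf⟩ := hS
  have hline {a b : Fin (m + 1) → F} := eval_add_smul_eq_zero_of_singular (by omega) hf hUf hVf hsing
    (fun x hx hxU y hy => exists_add_smul_mem_of_finrank le_sup_left (by omega) hx hxU hy)
    (fun x hx hxV y hy => exists_add_smul_mem_of_finrank le_sup_right (by omega) hx hxV hy)
    (a := a) (b := b)
  obtain ⟨W, ⟨hpW, hWL, hWf⟩, hmax⟩ := exists_maximal_of_wellFoundedGT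
    (fun W : Submodule F (Fin (m + 1) → F) =>
      p ∈ W ∧ W ≤ U ⊔ V ∧ ∀ x ∈ W, MvPolynomial.eval x f = 0)
    ⟨Submodule.span F {p}, Submodule.mem_span_singleton_self p,
      (Submodule.span_singleton_le_iff_mem _ _).mpr hpL, fun x hx => by
        obtain ⟨c, rfl⟩ := Submodule.mem_span_singleton.mp hx
        rw [hf.eval_smul_eq, hpf, mul_zero]⟩
  have hWmem : ∀ x ∈ U ⊔ V, MvPolynomial.eval x f = 0 → x ∈ U ∨ x ∈ V ∨ x ∈ W := by
    intro x hx hxf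
    by_contra! hc
    refine hc.2.2 (hmax (y := W ⊔ Submodule.span F {x}) ⟨Submodule.mem_sup_left hpW,
      sup_le hWL ((Submodule.span_singleton_le_iff_mem _ _).mpr hx), fun y hy => ?_⟩ le_sup_left
      (Submodule.mem_sup_right (Submodule.mem_span_singleton_self x)))
    obtain ⟨w, hw, z, hz, rfl⟩ := Submodule.mem_sup.mp hy
    obtain ⟨c, rfl⟩ := Submodule.mem_span_singleton.mp hz
    have := hf.totalDegree_le
    refine eval_eq_zero_of_forall_notMem (by omega) hpU hpV fun t htU htV => ?_
    have hmem := W.add_mem hw (W.smul_mem t hpW)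
    exact hline (hWL hmem) htU htV (hWf _ hmem) hx hc.1 hc.2.1 hxf c
  by_cases hW : Module.finrank F W ≤ s + 1
  · exact Or.inl ⟨W, hWL, hW, hWf, hWmem⟩
  · right
    have := Submodule.eq_of_le_of_finrank_le hWL (by omega)
    rwa [← this]
end

section
/- Let q be a prime power with q > 7, let m ≥ 2, and let f ∈ 𝔽_q[x₀,…,x_m] be a nonzero homogeneous polynomial of degree 7 with hypersurface X_f ⊂ P^m such that X_f has at least one 𝔽_q-point and f satisfies the point-count property (†). Let U be a linear subvariety of P^m defined over 𝔽_q, contained in X_f, of maximal dimension among all such linear subvarieties. Then either X_f has a smooth 𝔽_q-point, or there exist 𝔽_q-points v, w of X_f such that the line ⟨v,w⟩ is not contained in X_f and ⟨v,w⟩ ∩ U = ∅. -/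
lemma MvPolynomial.IsHomogeneous.eval_smul_eq_pow_mul {R σ : Type*} [CommSemiring R]
    {f : MvPolynomial σ R} {n : ℕ} (hf : f.IsHomogeneous n) (c : R) (x : σ → R) :
    eval (c • x) f = c ^ n * eval x f := by
  simp only [eval_eq, Finset.mul_sum]
  refine Finset.sum_congr rfl fun d hd => ?_
  have hdeg : d.degree = n := by
    rw [Finsupp.degree_eq_weight_one]
    exact hf (mem_support_iff.mp hd)
  simp only [Pi.smul_apply, smul_eq_mul, mul_pow, Finset.prod_mul_distrib,
    Finset.prod_pow_eq_pow_sum]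
  rw [← hdeg, Finsupp.degree_apply]
  ring

/-- A form of degree `n < #F` vanishing at all rational points of a line other than one
vanishes at the remaining point as well. -/
lemma MvPolynomial.IsHomogeneous.eval_eq_zero_of_forall_add_smul
    {F σ : Type*} [Field F] [Fintype F] {f : MvPolynomial σ F} {n : ℕ}
    (hf : f.IsHomogeneous n) (hn : n < Fintype.card F) {p v : σ → F}
    (hv : eval v f = 0) (hpv : ∀ t : F, t ≠ 0 → eval (p + t • v) f = 0) :
    eval p f = 0 := by
  have eval_smul_eq_zero (c : F) (x : σ → F) (hx : eval x f = 0) : eval (c • x) f = 0 := by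
    rw [hf.eval_smul_eq_pow_mul, hx, mul_zero]
  set g : MvPolynomial (Fin 2) F :=
    MvPolynomial.aeval (fun i => C (p i) * X 0 + C (v i) * X 1) f with hg_def
  have hg_eval (r : Fin 2 → F) : eval r g = eval (r 0 • p + r 1 • v) f := by
    rw [hg_def, aeval_def, eval_eval₂, eval, coe_eval₂Hom]
    congr 1
    · ext; simp
    · funext i
      simp [mul_comm]
  have hg : g.IsHomogeneous n := by
    have := hf.aeval (n := 1) (fun i => C (p i) * X 0 + C (v i) * X 1 : σ → MvPolynomial (Fin 2) F)
      (fun i => ((isHomogeneous_X F 0).C_mul _).add ((isHomogeneous_X F 1).C_mul _))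
    rwa [one_mul] at this
  have hXg : X 1 * g = 0 := by
    refine ((isHomogeneous_X F 1).mul hg).eq_zero_of_forall_eval_eq_zero_of_le_card (fun r => ?_)
      (by simpa [add_comm] using hn)
    rw [map_mul, eval_X, hg_eval]
    by_cases h1 : r 1 = 0
    · simp [h1]
    by_cases h0 : r 0 = 0
    · rw [h0, zero_smul, zero_add, eval_smul_eq_zero _ _ hv, mul_zero]
    · have := eval_smul_eq_zero (r 0) _ (hpv (r 1 / r 0) (div_ne_zero h1 h0))
      rw [smul_add, smul_smul, mul_div_cancel₀ _ h0] at this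
      rw [this, mul_zero]
  have hg0 : g = 0 := (mul_eq_zero.mp hXg).resolve_left (X_ne_zero 1)
  simpa [hg0] using (hg_eval ![1, 0]).symm

/-- Let `Z` be a cone which contains every line it meets in all but one point. If the span of any
two points of `Z` that are independent modulo `U` lies in `Z`, and `Z` is not contained in `U`
enlarged by a single point, then the part of `Z` outside `U` lies in a subspace inside `Z`. -/
lemma exists_submodule_subset_of_forall_add_mem {F V : Type*} [Field F] [AddCommGroup V]
    [Module F V] {Z : Set V} {U : Submodule F V}
    (hsmul : ∀ (c : F), ∀ x ∈ Z, c • x ∈ Z)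
    (hline : ∀ p, ∀ v ∈ Z, (∀ t : F, t ≠ 0 → p + t • v ∈ Z) → p ∈ Z)
    (hadd : ∀ v ∈ Z, v ∉ U → ∀ w ∈ Z, w ∉ U ⊔ F ∙ v → v + w ∈ Z)
    (hspread : ∀ v ∈ Z, v ∉ U → ∃ y ∈ Z, y ∉ U ⊔ F ∙ v) (hne : ∃ v ∈ Z, v ∉ U) :
    ∃ P : Submodule F V, (P : Set V) ⊆ Z ∧ Z \ U ⊆ P := by
  have smul_notMem {W : Submodule F V} {c : F} (hc : c ≠ 0) {x : V} (hx : x ∉ W) : c • x ∉ W :=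
    fun h => hx ((W.smul_mem_iff hc).mp h)
  have add_mem_of_notMem (v) (hvZ : v ∈ Z) (hvU : v ∉ U) (w) (hwZ : w ∈ Z) (hwU : w ∉ U) :
      v + w ∈ Z := by
    by_cases hw : w ∈ U ⊔ F ∙ v
    · obtain ⟨y, hyZ, hy⟩ := hspread v hvZ hvU
      refine hline _ y hyZ fun t ht => ?_
      have hty := smul_notMem ht hy
      have hv : v ∈ U ⊔ F ∙ v := le_sup_right (a := U) (Submodule.mem_span_singleton_self v)
      have hle : U ⊔ F ∙ w ≤ U ⊔ F ∙ v :=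
        sup_le le_sup_left ((Submodule.span_singleton_le_iff_mem _ _).mpr hw)
      have := hadd w hwZ hwU (v + t • y) (hadd v hvZ hvU _ (hsmul t y hyZ) hty)
        fun h => hty ((Submodule.add_mem_iff_right _ hv).mp (hle h))
      rwa [← add_assoc, add_comm w v] at this
    · exact hadd v hvZ hvU w hwZ hw
  let Q : V → Prop := fun x => ∀ s ∈ Z, s ∉ U → x + s ∈ Z
  have Q_add (x : V) (hx : Q x) (d : V) (hdZ : d ∈ Z) (hdU : d ∉ U) : Q (x + d) := by
    intro s hsZ hsU
    by_cases hds : d + s ∈ U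
    · refine hline _ s hsZ fun t ht => ?_
      have hmem : d + s + t • s ∉ U := fun h =>
        smul_notMem ht hsU ((Submodule.add_mem_iff_right _ hds).mp h)
      rw [add_assoc x d s, add_assoc x]
      refine hx _ ?_ hmem
      by_cases h1 : 1 + t = 0
      · have : d + s + t • s = d := by
          rw [add_assoc, show s + t • s = (1 + t) • s by rw [add_smul, one_smul], h1, zero_smul,
            add_zero]
        rwa [this]
      · rw [add_assoc, show s + t • s = (1 + t) • s by rw [add_smul, one_smul]]
        exact add_mem_of_notMem d hdZ hdU _ (hsmul _ _ hsZ) (smul_notMem h1 hsU)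
    · rw [add_assoc]
      exact hx _ (add_mem_of_notMem d hdZ hdU s hsZ hsU) hds
  have Q_smul (x : V) (hx : Q x) (c : F) (hc : c ≠ 0) : Q (c • x) := by
    intro s hsZ hsU
    have := hsmul c _ (hx _ (hsmul c⁻¹ s hsZ) (smul_notMem (inv_ne_zero hc) hsU))
    rwa [smul_add, smul_inv_smul₀ hc] at this
  refine ⟨{ carrier := {d | ∀ x, Q x → Q (x + d)}
            zero_mem' := fun x hx => by rwa [add_zero]
            add_mem' := fun {a b} ha hb x hx => by rw [← add_assoc]; exact hb _ (ha _ hx)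
            smul_mem' := fun c d hd x hx => ?_ }, fun d hd => ?_, fun d hd x hx => ?_⟩
  · by_cases hc : c = 0
    · rwa [hc, zero_smul, add_zero]
    · have := Q_smul _ (hd _ (Q_smul x hx c⁻¹ (inv_ne_zero hc))) c hc
      rwa [smul_add, smul_inv_smul₀ hc] at this
  · obtain ⟨v, hvZ, hvU⟩ := hne
    have hQd : Q (0 + d) := hd 0 fun s hsZ _ => by rwa [zero_add]
    rw [zero_add] at hQd
    exact hline d v hvZ fun t ht => hQd _ (hsmul t v hvZ) (smul_notMem ht hvU)
  · exact Q_add x hx d hd.1 hd.2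

/-- Counting the nonzero vectors representing a set of points of projective space. -/
lemma Projectivization.card_rep_mem_mul_lt {F V : Type*} [Field F] [Fintype F] [AddCommGroup V]
    [Module F V] [Finite V] {Z : Set V} (hzero : (0 : V) ∈ Z)
    (hsmul : ∀ (c : F), ∀ x ∈ Z, c • x ∈ Z) :
    (Fintype.card F - 1) * Nat.card {x : Projectivization F V // x.rep ∈ Z} < Z.ncard := by
  classical
  let φ : Fˣ × {x : Projectivization F V // x.rep ∈ Z} → V := fun y => (y.1 : F) • y.2.1.rep
  have hφ : Function.Injective φ := by
    rintro ⟨a, x, hx⟩ ⟨b, y, hy⟩ h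
    replace h : (a : F) • x.rep = (b : F) • y.rep := h
    have hxy : x = y := by
      rw [← x.mk_rep, ← y.mk_rep, Projectivization.mk_eq_mk_iff']
      refine ⟨(a : F)⁻¹ * b, ?_⟩
      rw [mul_smul, ← h, inv_smul_smul₀ a.ne_zero]
    subst hxy
    have := smul_left_injective F x.rep_nonzero h
    rw [Units.ext this]
  rw [← Fintype.card_units, ← Nat.card_eq_fintype_card, ← Nat.card_prod,
    ← Set.ncard_range_of_injective hφ]
  refine Set.ncard_lt_ncard ⟨?_, fun h => ?_⟩ (Set.toFinite _)
  · rintro _ ⟨⟨a, x, hx⟩, rfl⟩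
    exact hsmul _ _ hx
  · obtain ⟨⟨a, x, hx⟩, h0⟩ := h hzero
    exact smul_ne_zero a.ne_zero x.rep_nonzero h0


/-- **Lemma 4.3 (skew points).** Let `q > 7`, `m ≥ 2`, and `f` a nonzero degree-7
form in `m + 1` variables over `𝔽_q` with hypersurface `X_f`, having at least one
`𝔽_q`-point and satisfying the point-count property (†): whenever `X_f` contains
a linear subvariety of projective dimension `s` (a subspace of dimension `s + 1`),
`#X_f(𝔽_q) ≥ (q^{s+2} - 1)/(q - 1)`. Let `U` be a linear subvariety contained in
`X_f` of maximal dimension among all such. Then either `X_f` has a smooth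
`𝔽_q`-point, or there exist `𝔽_q`-points `v, w` of `X_f` such that the line
`⟨v, w⟩` is not contained in `X_f` and is disjoint from `U` (the corresponding
subspaces intersect trivially). -/
theorem stmt15 (q m : ℕ) (hq7 : 7 < q) (hm : 2 ≤ m)
    (F : Type*) [Field F] [Fintype F] (hq : Fintype.card F = q)
    (f : MvPolynomial (Fin (m + 1)) F) (hf0 : f ≠ 0) (hf : f.IsHomogeneous 7)
    (hpt : ∃ a : Fin (m + 1) → F, a ≠ 0 ∧ MvPolynomial.eval a f = 0)
    (hdagger : ∀ s : ℕ,
      (∃ W : Submodule F (Fin (m + 1) → F), Module.finrank F W = s + 1 ∧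
        ∀ x ∈ W, MvPolynomial.eval x f = 0) →
      q ^ (s + 2) - 1 ≤ (q - 1) *
        Nat.card {x : Projectivization F (Fin (m + 1) → F) //
          MvPolynomial.eval x.rep f = 0})
    (U : Submodule F (Fin (m + 1) → F)) (hUdim : 1 ≤ Module.finrank F U)
    (hUf : ∀ x ∈ U, MvPolynomial.eval x f = 0)
    (hUmax : ∀ W : Submodule F (Fin (m + 1) → F),
      (∀ x ∈ W, MvPolynomial.eval x f = 0) →
      Module.finrank F W ≤ Module.finrank F U) :
    (∃ a : Fin (m + 1) → F, a ≠ 0 ∧ MvPolynomial.eval a f = 0 ∧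
        ∃ i, MvPolynomial.eval a (MvPolynomial.pderiv i f) ≠ 0) ∨
    (∃ v w : Fin (m + 1) → F,
        MvPolynomial.eval v f = 0 ∧ MvPolynomial.eval w f = 0 ∧
        LinearIndependent F ![v, w] ∧
        (∃ x ∈ Submodule.span F {v, w}, MvPolynomial.eval x f ≠ 0) ∧
        Submodule.span F {v, w} ⊓ U = ⊥) := by
  right
  by_contra hcon
  have eval_smul (c : F) (x : Fin (m + 1) → F) (hx : MvPolynomial.eval x f = 0) :
      MvPolynomial.eval (c • x) f = 0 := by
    rw [hf.eval_smul_eq_pow_mul, hx, mul_zero]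
  set Z : Set (Fin (m + 1) → F) := {x | MvPolynomial.eval x f = 0}
  have hzero : 0 ∈ Z := hUf 0 U.zero_mem
  have card_submodule (W : Submodule F (Fin (m + 1) → F)) :
      (W : Set (Fin (m + 1) → F)).ncard = q ^ Module.finrank F W := by
    rw [← hq, ← Nat.card_eq_fintype_card]
    exact Module.natCard_eq_pow_finrank
  have hle : q ^ (Module.finrank F U + 1) ≤ Z.ncard := by
    have h1 := hdagger (Module.finrank F U - 1) ⟨U, by omega, hUf⟩
    have h2 := Projectivization.card_rep_mem_mul_lt hzero eval_smul
    rw [hq] at h2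
    rw [show Module.finrank F U - 1 + 2 = Module.finrank F U + 1 by omega] at h1
    have h3 := lt_of_le_of_lt h1 h2
    omega
  have hpow : 2 * q ^ Module.finrank F U < q ^ (Module.finrank F U + 1) := by
    rw [pow_succ']
    exact Nat.mul_lt_mul_of_pos_right (by omega) (by positivity)
  obtain ⟨P, hPZ, hZP⟩ := exists_submodule_subset_of_forall_add_mem (U := U) eval_smul
    (fun p v hv => hf.eval_eq_zero_of_forall_add_smul (by omega) hv)
    (fun v hvZ hvU w hwZ hw => by
      have hindep (a b : F) (h : a • v + b • w ∈ U) : a = 0 ∧ b = 0 := by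
        have hb : b = 0 := by
          by_contra hb
          refine hw (((U ⊔ F ∙ v).smul_mem_iff hb).mp ?_)
          refine (Submodule.add_mem_iff_right _ ?_).mp (Submodule.mem_sup_left h)
          exact Submodule.mem_sup_right
            (Submodule.smul_mem _ _ (Submodule.mem_span_singleton_self v))
        subst hb
        refine ⟨?_, rfl⟩
        by_contra ha
        rw [zero_smul, add_zero] at h
        exact hvU ((U.smul_mem_iff ha).mp h)
      by_contra hvw
      refine hcon ⟨v, w, hvZ, hwZ, ?_, ⟨v + w, ?_, hvw⟩, ?_⟩
      · exact LinearIndependent.pair_iff.mpr fun a b h => hindep a b (h ▸ U.zero_mem)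
      · exact Submodule.add_mem _ (Submodule.subset_span (by simp))
          (Submodule.subset_span (by simp))
      · refine (Submodule.eq_bot_iff _).mpr fun x hx => ?_
        obtain ⟨hx1, hx2⟩ := Submodule.mem_inf.mp hx
        obtain ⟨a, b, rfl⟩ := Submodule.mem_span_pair.mp hx1
        obtain ⟨rfl, rfl⟩ := hindep a b hx2
        simp)
    (fun v hvZ hvU => by
      by_contra! hsub
      have hcard := card_submodule (U ⊔ F ∙ v)
      have hfin : Module.finrank F ↥(U ⊔ F ∙ v) ≤ Module.finrank F U + 1 :=
        (Submodule.finrank_add_le_finrank_add_finrank _ _).trans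
          (Nat.add_le_add_left ((finrank_span_le_card {v}).trans (by simp)) _)
      have hZeq : Z = (U ⊔ F ∙ v : Submodule F (Fin (m + 1) → F)) :=
        Set.eq_of_subset_of_ncard_le hsub
          (hcard.trans_le ((Nat.pow_le_pow_right (by omega) hfin).trans hle))
      have hmax := hUmax (U ⊔ F ∙ v) fun x hx => by
        have : x ∈ Z := hZeq ▸ hx
        exact this
      have heq : U = U ⊔ F ∙ v := Submodule.eq_of_le_of_finrank_le le_sup_left hmax
      exact hvU (heq ▸ Submodule.mem_sup_right (Submodule.mem_span_singleton_self v)))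
    (by
      by_contra! hsub
      have := Set.ncard_le_ncard (show Z ⊆ U from hsub) (Set.toFinite _)
      rw [card_submodule] at this
      omega)
  have hPU := hUmax P hPZ
  have hZle : Z.ncard ≤ q ^ Module.finrank F P + q ^ Module.finrank F U := by
    rw [← card_submodule, ← card_submodule]
    refine (Set.ncard_le_ncard (fun x hx => ?_) (Set.toFinite _)).trans (Set.ncard_union_le _ _)
    by_cases hxU : x ∈ U
    · exact Or.inr hxU
    · exact Or.inl (hZP ⟨hx, hxU⟩)
  have := Nat.pow_le_pow_right (show 0 < q by omega) hPU
  omega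
end
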